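/- arXiv:2312.07681 — 12 statements merged into one kernel-verified Lean document; each statement's English description precedes it below -/
import Mathlib

section
/- Cycle-basis independence of the Newton–Raphson loop iteration (Proposition 3.1): Fix ψ ∈ ℝ^m, an m×k real matrix A, and an invertible k×k real matrix W, and set B = A·W. For a matrix M ∈ ℝ^{m×k} define q_M(x) = ψ + M·x, U_M(x) = diag(|q_M(x)_e|)_{e=1..m}, F_M(x) = Mᵀ·U_M(x)·q_M(x) and J_M(x) = 2·Mᵀ·U_M(x)·M. Define the Newton sequences x_A⁽⁰⁾ = 0, x_B⁽⁰⁾ = 0 and, whenever the Jacobians are invertible, x_A⁽ᵗ⁾ = x_A⁽ᵗ⁻¹⁾ − J_A(x_A⁽ᵗ⁻¹⁾)⁻¹·F_A(x_A⁽ᵗ⁻¹⁾) and x_B⁽ᵗ⁾ = x_B⁽ᵗ⁻¹⁾ − J_B(x_B⁽ᵗ⁻¹⁾)⁻¹·F_B(x_B⁽ᵗ⁻¹⁾). Then for every t ≥ 0: J_A(x_A⁽ᵗ⁾) is invertible if and only if J_B(x_B⁽ᵗ⁾) is invertible, and (as long as the iterates are defined) A·x_A⁽ᵗ⁾ = B·x_B⁽ᵗ⁾,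 i.e. the flows q_A(x_A⁽ᵗ⁾) and q_B(x_B⁽ᵗ⁾) obtained at each step coincide. -/
open Matrix

/-- The adjusted flow `q(x) = ψ + M x`. -/
noncomputable def qFlow {m k : ℕ} (ψ : Fin m → ℝ) (M : Matrix (Fin m) (Fin k) ℝ)
    (x : Fin k → ℝ) : Fin m → ℝ :=
  ψ + M.mulVec x

/-- The diagonal matrix `U_M(x) = diag(|q_M(x)_e|)`. -/
noncomputable def Umat {m k : ℕ} (ψ : Fin m → ℝ) (M : Matrix (Fin m) (Fin k) ℝ)
    (x : Fin k → ℝ) : Matrix (Fin m) (Fin m) ℝ :=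
  Matrix.diagonal fun e => |qFlow ψ M x e|

/-- The loop error function `F_M(x) = Mᵀ · U_M(x) · q_M(x)`. -/
noncomputable def Fmap {m k : ℕ} (ψ : Fin m → ℝ) (M : Matrix (Fin m) (Fin k) ℝ)
    (x : Fin k → ℝ) : Fin k → ℝ :=
  Mᵀ.mulVec ((Umat ψ M x).mulVec (qFlow ψ M x))

/-- The Jacobian `J_M(x) = 2 · Mᵀ · U_M(x) · M` of the loop error function. -/
noncomputable def Jmat {m k : ℕ} (ψ : Fin m → ℝ) (M : Matrix (Fin m) (Fin k) ℝ)
    (x : Fin k → ℝ) : Matrix (Fin k) (Fin k) ℝ :=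
  (2 : ℝ) • (Mᵀ * Umat ψ M x * M)

/-- The Newton–Raphson sequence for the loop equations, starting at `0`. -/
noncomputable def nrSeq {m k : ℕ} (ψ : Fin m → ℝ) (M : Matrix (Fin m) (Fin k) ℝ) :
    ℕ → Fin k → ℝ
  | 0 => 0
  | t + 1 =>
      nrSeq ψ M t - (Jmat ψ M (nrSeq ψ M t))⁻¹.mulVec (Fmap ψ M (nrSeq ψ M t))

theorem qFlow_basis {m k : ℕ} (ψ : Fin m → ℝ) (A : Matrix (Fin m) (Fin k) ℝ)
    (W : Matrix (Fin k) (Fin k) ℝ) (y : Fin k → ℝ) :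
    qFlow ψ (A * W) y = qFlow ψ A (W.mulVec y) := by
  simp [qFlow, Matrix.mulVec_mulVec]

theorem Umat_basis {m k : ℕ} (ψ : Fin m → ℝ) (A : Matrix (Fin m) (Fin k) ℝ)
    (W : Matrix (Fin k) (Fin k) ℝ) (y : Fin k → ℝ) :
    Umat ψ (A * W) y = Umat ψ A (W.mulVec y) := by
  simp only [Umat, qFlow_basis]

theorem Fmap_basis {m k : ℕ} (ψ : Fin m → ℝ) (A : Matrix (Fin m) (Fin k) ℝ)
    (W : Matrix (Fin k) (Fin k) ℝ) (y : Fin k → ℝ) :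
    Fmap ψ (A * W) y = Wᵀ.mulVec (Fmap ψ A (W.mulVec y)) := by
  simp only [Fmap, Umat_basis, qFlow_basis, Matrix.transpose_mul, Matrix.mulVec_mulVec,
    Matrix.mul_assoc]

theorem Jmat_basis {m k : ℕ} (ψ : Fin m → ℝ) (A : Matrix (Fin m) (Fin k) ℝ)
    (W : Matrix (Fin k) (Fin k) ℝ) (y : Fin k → ℝ) :
    Jmat ψ (A * W) y = Wᵀ * Jmat ψ A (W.mulVec y) * W := by
  simp only [Jmat, Umat_basis, Matrix.transpose_mul, Matrix.mul_assoc, Matrix.mul_smul,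
    Matrix.smul_mul]

theorem nrSeq_basis {m k : ℕ} (ψ : Fin m → ℝ) (A : Matrix (Fin m) (Fin k) ℝ)
    (W : Matrix (Fin k) (Fin k) ℝ) (hW : IsUnit W) (t : ℕ) :
    W.mulVec (nrSeq ψ (A * W) t) = nrSeq ψ A t := by
  have hd : IsUnit W.det := (Matrix.isUnit_iff_isUnit_det W).1 hW
  have hdT : IsUnit Wᵀ.det := by rwa [Matrix.det_transpose]
  induction t with
  | zero => simp [nrSeq]
  | succ t ih =>
    simp only [nrSeq, Matrix.mulVec_sub, Jmat_basis, Fmap_basis, ih, Matrix.mul_inv_rev,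
      Matrix.mulVec_mulVec]
    rw [← Matrix.mul_assoc, ← Matrix.mul_assoc, Matrix.mul_nonsing_inv _ hd, Matrix.one_mul,
      Matrix.mul_assoc, Matrix.nonsing_inv_mul _ hdT, Matrix.mul_one]

/-- Proposition 3.1 (cycle-basis independence of the Newton–Raphson loop iteration):
with `B = A * W` for an invertible change-of-basis matrix `W`, provided the Jacobians at
all previous iterates are invertible, at step `t` the Jacobian for `A` is invertible iff the
Jacobian for `B` is, and the flows obtained coincide: `A·x_A⁽ᵗ⁾ = B·x_B⁽ᵗ⁾`. -/
theorem nrLoop_basis_independent {m k : ℕ} (ψ : Fin m → ℝ)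
    (A : Matrix (Fin m) (Fin k) ℝ)
    (W : Matrix (Fin k) (Fin k) ℝ) (hW : IsUnit W)
    (B : Matrix (Fin m) (Fin k) ℝ) (hB : B = A * W)
    (t : ℕ) (hprev : ∀ s < t, IsUnit (Jmat ψ A (nrSeq ψ A s))) :
    (IsUnit (Jmat ψ A (nrSeq ψ A t)) ↔ IsUnit (Jmat ψ B (nrSeq ψ B t))) ∧
    A.mulVec (nrSeq ψ A t) = B.mulVec (nrSeq ψ B t) := by
  subst hB
  have hd : IsUnit W.det := (Matrix.isUnit_iff_isUnit_det W).1 hW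
  have hx := nrSeq_basis ψ A W hW t
  refine ⟨?_, ?_⟩
  · rw [Jmat_basis, hx, Matrix.isUnit_iff_isUnit_det, Matrix.isUnit_iff_isUnit_det,
      Matrix.det_mul, Matrix.det_mul, Matrix.det_transpose, IsUnit.mul_iff, IsUnit.mul_iff]
    tauto
  · rw [← Matrix.mulVec_mulVec, hx]
end

section
/- General Lipschitz bound for the Jacobian (Claim 3.3): Fix positive integers m, k and an integer ℓ. Let A be an m×k real matrix all of whose entries lie in {−1, 0, 1}, and suppose that for every column index c one has Σ_{d=1}^k Σ_{e=1}^m |A_{ec}|·|A_{ed}| ≤ ℓ − k + 1. Fix ψ ∈ ℝ^m, let q(x)_e = ψ_e + Σ_{i=1}^k A_{ei} x_i, and let J(x) be the k×k matrix with entries J(x)_{cd} = 2 Σ_{e=1}^m A_{ec} A_{ed} |q(x)_e|. Then for all x, y ∈ ℝ^k: ‖J(x) − J(y)‖ ≤ 2k(ℓ − k + 1)·‖x − y‖, where ‖x‖ = max_c |x_c| is the sup norm on ℝ^k and ‖M‖ = max_c Σ_d |M_{cd}| is the induced operator norm (maximum absolute row sum) on k×k matrices. -/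
open Matrix

/-- Maximum absolute row sum norm on `k × k` real matrices
(the operator norm induced by the sup norm on `ℝ^k`). -/
noncomputable def rowSumNorm {k : ℕ} (M : Matrix (Fin k) (Fin k) ℝ) : ℝ :=
  ⨆ c, ∑ d, |M c d|

/-- Claim 3.3 (general Lipschitz bound for the Jacobian): if `A` has entries in `{-1,0,1}`
and `Σ_d Σ_e |A_{ec}||A_{ed}| ≤ ℓ - k + 1` for every column `c`, then the Jacobian
`J(x)_{cd} = 2 Σ_e A_{ec} A_{ed} |q(x)_e|` of the loop error function satisfies
`‖J(x) - J(y)‖ ≤ 2k(ℓ - k + 1)‖x - y‖`.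
The norm on `ℝ^k = Fin k → ℝ` is the sup norm `‖x‖ = max_c |x_c|`. -/
theorem jacobian_lipschitz {m k : ℕ} (hm : 0 < m) (hk : 0 < k) (ℓ : ℤ)
    (A : Matrix (Fin m) (Fin k) ℝ)
    (hA : ∀ e c, A e c = -1 ∨ A e c = 0 ∨ A e c = 1)
    (hcol : ∀ c, ∑ d, ∑ e, |A e c| * |A e d| ≤ (ℓ : ℝ) - k + 1)
    (ψ : Fin m → ℝ)
    (q : (Fin k → ℝ) → Fin m → ℝ)
    (hq : ∀ x e, q x e = ψ e + ∑ i, A e i * x i)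
    (J : (Fin k → ℝ) → Matrix (Fin k) (Fin k) ℝ)
    (hJ : ∀ x c d, J x c d = 2 * ∑ e, A e c * A e d * |q x e|)
    (x y : Fin k → ℝ) :
    rowSumNorm (J x - J y) ≤ 2 * k * ((ℓ : ℝ) - k + 1) * ‖x - y‖ := by
  have hqd : ∀ e, |(|q x e| - |q y e|)| ≤ k * ‖x - y‖ := by
    intro e
    refine (abs_abs_sub_abs_le_abs_sub _ _).trans ?_
    have h1 : q x e - q y e = ∑ i, A e i * (x - y) i := by
      simp only [hq, Pi.sub_apply, mul_sub, Finset.sum_sub_distrib]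
      ring
    rw [h1]
    refine (Finset.abs_sum_le_sum_abs _ _).trans ?_
    have h2 : ∀ i ∈ Finset.univ, |A e i * (x - y) i| ≤ ‖x - y‖ := by
      intro i _
      have h3 : |(x - y) i| ≤ ‖x - y‖ := norm_le_pi_norm (x - y) i
      have h4 : |A e i| ≤ 1 := by
        rcases hA e i with h | h | h <;> simp [h]
      rw [abs_mul]
      calc |A e i| * |(x - y) i| ≤ 1 * ‖x - y‖ :=
            mul_le_mul h4 h3 (abs_nonneg _) zero_le_one
        _ = ‖x - y‖ := one_mul _
    refine (Finset.sum_le_sum h2).trans ?_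
    simp
  have : Nonempty (Fin k) := ⟨⟨0, hk⟩⟩
  unfold rowSumNorm
  refine ciSup_le fun c => ?_
  have hentry : ∀ d ∈ Finset.univ, |(J x - J y) c d| ≤
      (∑ e, |A e c| * |A e d|) * (2 * (k * ‖x - y‖)) := by
    intro d _
    have h1 : (J x - J y) c d = 2 * ∑ e, A e c * A e d * (|q x e| - |q y e|) := by
      simp only [Matrix.sub_apply, hJ, mul_sub, Finset.sum_sub_distrib]
    have h2 : |∑ e, A e c * A e d * (|q x e| - |q y e|)| ≤
        (∑ e, |A e c| * |A e d|) * (k * ‖x - y‖) := by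
      refine (Finset.abs_sum_le_sum_abs _ _).trans ?_
      rw [Finset.sum_mul]
      refine Finset.sum_le_sum fun e _ => ?_
      rw [abs_mul, abs_mul]
      exact mul_le_mul_of_nonneg_left (hqd e) (by positivity)
    rw [h1, abs_mul, abs_two]
    linarith
  refine (Finset.sum_le_sum hentry).trans ?_
  rw [← Finset.sum_mul]
  have h5 := mul_le_mul_of_nonneg_right (hcol c)
    (show (0 : ℝ) ≤ 2 * (k * ‖x - y‖) by positivity)
  linarith
end

section
/- Kantorovich theorem in ℝ^k with the sup norm (Theorem 3.1 as used in the paper): Let F : ℝ^k → ℝ^k be differentiable with Jacobian F'(x), and let x⁽⁰⁾ ∈ ℝ^k. Assume there are constants β, η, L > 0 with: (1) F'(x⁽⁰⁾) is invertible and ‖F'(x⁽⁰⁾)⁻¹‖ ≤ β; (2) ‖F'(x⁽⁰⁾)⁻¹·F(x⁽⁰⁾)‖ ≤ η; (3) ‖F'(x) − F'(y)‖ ≤ L‖x − y‖ for all x, y ∈ ℝ^k. If h = βηL < 1/2 and r = (1 − √(1 − 2h))/(βL), then the Newton sequence x⁽ᵗ⁾ = x⁽ᵗ⁻¹⁾ −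 F'(x⁽ᵗ⁻¹⁾)⁻¹·F(x⁽ᵗ⁻¹⁾) is well defined (each F'(x⁽ᵗ⁾) is invertible), all iterates lie in the closed ball B(x⁽⁰⁾, r), and the sequence converges to a point x* with F(x*) = 0, x* being the unique zero of F in B(x⁽⁰⁾, r); moreover the convergence is quadratic: there is a constant C ≥ 0 such that ‖x⁽ᵗ⁾ − x*‖ ≤ C‖x⁽ᵗ⁻¹⁾ − x*‖² for all t ≥ 1. -/
open Matrix Filter

/-- The Newton–Raphson sequence `x⁽ᵗ⁾ = x⁽ᵗ⁻¹⁾ - J(x⁽ᵗ⁻¹⁾)⁻¹ F(x⁽ᵗ⁻¹⁾)` starting at `x0`. -/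
noncomputable def newtonSeq {k : ℕ} (F : (Fin k → ℝ) → Fin k → ℝ)
    (J : (Fin k → ℝ) → Matrix (Fin k) (Fin k) ℝ) (x0 : Fin k → ℝ) : ℕ → Fin k → ℝ
  | 0 => x0
  | t + 1 =>
      newtonSeq F J x0 t - (J (newtonSeq F J x0 t))⁻¹.mulVec (F (newtonSeq F J x0 t))

lemma rowSum_mulVec_le {k : ℕ} (M : Matrix (Fin k) (Fin k) ℝ) (v : Fin k → ℝ) :
    ‖M.mulVec v‖ ≤ rowSumNorm M * ‖v‖ := by
  have h0 : 0 ≤ rowSumNorm M :=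
    Real.iSup_nonneg fun c => Finset.sum_nonneg fun d _ => abs_nonneg _
  rw [pi_norm_le_iff_of_nonneg (by positivity)]
  intro c
  have h1 : ∑ d, |M c d| ≤ rowSumNorm M :=
    le_ciSup (f := fun c => ∑ d, |M c d|) (Set.finite_range _).bddAbove c
  calc ‖M.mulVec v c‖ = |∑ d, M c d * v d| := by simp [Matrix.mulVec, dotProduct]
    _ ≤ ∑ d, |M c d * v d| := Finset.abs_sum_le_sum_abs _ _
    _ ≤ ∑ d, |M c d| * ‖v‖ := by
        refine Finset.sum_le_sum fun d _ => ?_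
        rw [abs_mul]
        exact mul_le_mul_of_nonneg_left (norm_le_pi_norm v d) (abs_nonneg _)
    _ = (∑ d, |M c d|) * ‖v‖ := by rw [Finset.sum_mul]
    _ ≤ _ := mul_le_mul_of_nonneg_right h1 (norm_nonneg _)

lemma newton_taylor {k : ℕ} (F : (Fin k → ℝ) → Fin k → ℝ)
    (J : (Fin k → ℝ) → Matrix (Fin k) (Fin k) ℝ)
    (hdiff : ∀ x, HasFDerivAt F (LinearMap.toContinuousLinearMap (J x).mulVecLin) x)
    (L : ℝ) (hLip : ∀ x y, rowSumNorm (J x - J y) ≤ L * ‖x - y‖) (x y : Fin k → ℝ) :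
    ‖F y - F x - (J x).mulVec (y - x)‖ ≤ L / 2 * ‖y - x‖ ^ 2 := by
  have hg : ∀ τ : ℝ, HasDerivAt
      (fun τ : ℝ => F (x + τ • (y - x)) - F x - τ • (J x).mulVec (y - x))
      ((J (x + τ • (y - x))).mulVec (y - x) - (J x).mulVec (y - x)) τ := by
    intro τ
    have h1 : HasDerivAt (fun τ : ℝ => x + τ • (y - x)) (y - x) τ := by
      simpa using ((hasDerivAt_id τ).smul_const (y - x)).const_add x
    have h2 := (hdiff (x + τ • (y - x))).comp_hasDerivAt τ h1
    have h3 : HasDerivAt (fun τ : ℝ => τ • (J x).mulVec (y - x)) ((J x).mulVec (y - x)) τ := by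
      simpa using (hasDerivAt_id τ).smul_const ((J x).mulVec (y - x))
    exact (h2.sub_const (F x)).sub h3
  have hB : ∀ τ : ℝ, HasDerivAt (fun τ : ℝ => L / 2 * ‖y - x‖ ^ 2 * τ ^ 2)
      (L * ‖y - x‖ ^ 2 * τ) τ := by
    intro τ
    have := ((hasDerivAt_id τ).pow 2).const_mul (L / 2 * ‖y - x‖ ^ 2)
    have e : L / 2 * ‖y - x‖ ^ 2 * (((2 : ℕ) : ℝ) * id τ ^ (2 - 1) * 1) = L * ‖y - x‖ ^ 2 * τ := by
      norm_num
      ring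
    rw [e] at this
    exact this
  have key := image_norm_le_of_norm_deriv_right_le_deriv_boundary (a := (0:ℝ)) (b := 1)
    (f := fun τ : ℝ => F (x + τ • (y - x)) - F x - τ • (J x).mulVec (y - x))
    (f' := fun τ => (J (x + τ • (y - x))).mulVec (y - x) - (J x).mulVec (y - x))
    (B := fun τ : ℝ => L / 2 * ‖y - x‖ ^ 2 * τ ^ 2)
    (B' := fun τ => L * ‖y - x‖ ^ 2 * τ)
    (fun τ _ => (hg τ).continuousAt.continuousWithinAt)
    (fun τ _ => (hg τ).hasDerivWithinAt) (by simp) hB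
    (by
      intro τ hτ
      rw [← Matrix.sub_mulVec]
      refine (rowSum_mulVec_le _ _).trans ?_
      refine (mul_le_mul_of_nonneg_right (hLip _ _) (norm_nonneg _)).trans_eq ?_
      rw [add_sub_cancel_left, norm_smul, Real.norm_of_nonneg hτ.1]
      ring)
  have := key (Set.right_mem_Icc.2 zero_le_one)
  simpa using this

lemma newton_inv_bound {k : ℕ} (J : (Fin k → ℝ) → Matrix (Fin k) (Fin k) ℝ)
    (x0 : Fin k → ℝ) (β L : ℝ) (hβpos : 0 < β) (hLpos : 0 < L)
    (hinv : IsUnit (J x0)) (hβ : rowSumNorm (J x0)⁻¹ ≤ β)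
    (hLip : ∀ x y, rowSumNorm (J x - J y) ≤ L * ‖x - y‖)
    (x : Fin k → ℝ) (s : ℝ) (hx : ‖x - x0‖ ≤ s) (hs : 0 < 1 - β * L * s) :
    IsUnit (J x) ∧ ∀ u, ‖(J x)⁻¹.mulVec u‖ ≤ β / (1 - β * L * s) * ‖u‖ := by
  have hBb : ∀ u, ‖(J x0)⁻¹.mulVec u‖ ≤ β * ‖u‖ := fun u =>
    (rowSum_mulVec_le _ _).trans (mul_le_mul_of_nonneg_right hβ (norm_nonneg _))
  have hdet0 := (Matrix.isUnit_iff_isUnit_det _).1 hinv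
  have key : ∀ v, (1 - β * L * s) * ‖v‖ ≤ β * ‖(J x).mulVec v‖ := by
    intro v
    have e : v = (J x0)⁻¹.mulVec ((J x).mulVec v) + (J x0)⁻¹.mulVec ((J x0 - J x).mulVec v) := by
      rw [← Matrix.mulVec_add, Matrix.sub_mulVec, add_sub_cancel, Matrix.mulVec_mulVec,
        Matrix.nonsing_inv_mul _ hdet0, Matrix.one_mulVec]
    have h1 : ‖(J x0 - J x).mulVec v‖ ≤ L * s * ‖v‖ := by
      refine (rowSum_mulVec_le _ _).trans (mul_le_mul_of_nonneg_right ?_ (norm_nonneg _))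
      refine (hLip _ _).trans (mul_le_mul_of_nonneg_left ?_ hLpos.le)
      rwa [norm_sub_rev]
    have h2 : ‖v‖ ≤ β * ‖(J x).mulVec v‖ + β * (L * s * ‖v‖) := by
      calc ‖v‖ = ‖(J x0)⁻¹.mulVec ((J x).mulVec v) + (J x0)⁻¹.mulVec ((J x0 - J x).mulVec v)‖ :=
            congrArg _ e
        _ ≤ _ := norm_add_le _ _
        _ ≤ _ := add_le_add (hBb _) ((hBb _).trans (mul_le_mul_of_nonneg_left h1 hβpos.le))
    linarith
  have hU : IsUnit (J x) := by
    rw [← Matrix.mulVec_injective_iff_isUnit]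
    intro v w hvw
    have h := key (v - w)
    replace hvw : (J x).mulVec v = (J x).mulVec w := hvw
    rw [Matrix.mulVec_sub, hvw, sub_self, norm_zero, mul_zero] at h
    have : ‖v - w‖ = 0 := le_antisymm (by by_contra hc; push Not at hc; nlinarith) (norm_nonneg _)
    exact sub_eq_zero.1 (norm_eq_zero.1 this)
  refine ⟨hU, fun u => ?_⟩
  have h := key ((J x)⁻¹.mulVec u)
  rw [Matrix.mulVec_mulVec, Matrix.mul_nonsing_inv _ ((Matrix.isUnit_iff_isUnit_det _).1 hU),
    Matrix.one_mulVec] at h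
  rw [div_mul_eq_mul_div, le_div_iff₀ hs]
  linarith

lemma newton_scalar (a η r s : ℝ) (ha : 0 < a) (har : a * r < 1)
    (hroot : a / 2 * r ^ 2 - r + η = 0) (hs : s ≤ r) :
    0 ≤ (a / 2 * s ^ 2 - s + η) / (1 - a * s) ∧
    s + (a / 2 * s ^ 2 - s + η) / (1 - a * s) ≤ r := by
  have h1 : a * s ≤ a * r := mul_le_mul_of_nonneg_left hs ha.le
  have hpos : 0 < 1 - a * s := by linarith
  have hp : a / 2 * s ^ 2 - s + η = (r - s) * (1 - a * (s + r) / 2) := by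
    linear_combination hroot
  constructor
  · apply div_nonneg _ hpos.le
    rw [hp]
    apply mul_nonneg <;> linarith
  · rw [← le_sub_iff_add_le', div_le_iff₀ hpos, hp]
    apply mul_le_mul_of_nonneg_left <;> linarith

/-- Theorem 3.1 (Kantorovich, in `ℝ^k` with the sup norm): under the assumptions
(1) `J(x⁽⁰⁾)` invertible with `‖J(x⁽⁰⁾)⁻¹‖ ≤ β`, (2) `‖J(x⁽⁰⁾)⁻¹ F(x⁽⁰⁾)‖ ≤ η`,
(3) `‖J(x) - J(y)‖ ≤ L‖x - y‖`, if `h = βηL < 1/2` and `r = (1 - √(1-2h))/(βL)`,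
then the Newton sequence is well defined (all Jacobians invertible), stays in the closed
ball `B(x⁽⁰⁾, r)`, and converges quadratically to the unique zero `x*` of `F` in that ball. -/
theorem kantorovich_newton {k : ℕ} (hk : 0 < k)
    (F : (Fin k → ℝ) → Fin k → ℝ)
    (J : (Fin k → ℝ) → Matrix (Fin k) (Fin k) ℝ)
    (hdiff : ∀ x, HasFDerivAt F (LinearMap.toContinuousLinearMap (J x).mulVecLin) x)
    (x0 : Fin k → ℝ) (β η L : ℝ) (hβpos : 0 < β) (hηpos : 0 < η) (hLpos : 0 < L)
    (hinv : IsUnit (J x0))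
    (hβ : rowSumNorm (J x0)⁻¹ ≤ β)
    (hη : ‖(J x0)⁻¹.mulVec (F x0)‖ ≤ η)
    (hLip : ∀ x y, rowSumNorm (J x - J y) ≤ L * ‖x - y‖)
    (hh : β * η * L < 1 / 2)
    (r : ℝ) (hr : r = (1 - Real.sqrt (1 - 2 * (β * η * L))) / (β * L)) :
    (∀ t, IsUnit (J (newtonSeq F J x0 t))) ∧
    (∀ t, ‖newtonSeq F J x0 t - x0‖ ≤ r) ∧
    ∃ xstar : Fin k → ℝ, F xstar = 0 ∧ ‖xstar - x0‖ ≤ r ∧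
      (∀ y, ‖y - x0‖ ≤ r → F y = 0 → y = xstar) ∧
      Tendsto (newtonSeq F J x0) atTop (nhds xstar) ∧
      ∃ C : ℝ, 0 ≤ C ∧
        ∀ t : ℕ, ‖newtonSeq F J x0 (t + 1) - xstar‖ ≤ C * ‖newtonSeq F J x0 t - xstar‖ ^ 2 := by
  set h := β * η * L with hhdef
  have hβL : 0 < β * L := mul_pos hβpos hLpos
  have hsq0 : 0 < 1 - 2 * h := by linarith
  have hsqrt : Real.sqrt (1 - 2 * h) ^ 2 = 1 - 2 * h := Real.sq_sqrt hsq0.le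
  have hsqpos : 0 < Real.sqrt (1 - 2 * h) := Real.sqrt_pos.2 hsq0
  have hq : β * L * r = 1 - Real.sqrt (1 - 2 * h) := by
    rw [hr]; field_simp
  have har : β * L * r < 1 := by linarith
  have hroot : (β * L) / 2 * r ^ 2 - r + η = 0 := by
    have h1 : (β * L) * ((β * L) / 2 * r ^ 2 - r + η) = 0 := by
      have : Real.sqrt (1 - 2 * h) = 1 - β * L * r := by linarith
      rw [this, hhdef] at hsqrt
      linear_combination hsqrt / 2
    exact (mul_eq_zero.1 h1).resolve_left hβL.ne'
  have hr0 : 0 ≤ r := by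
    have hpos : 0 < h := by positivity
    have : Real.sqrt (1 - 2 * h) ≤ 1 := Real.sqrt_le_one.2 (by linarith)
    rw [hr]; exact div_nonneg (by linarith) hβL.le
  have hT := newton_taylor F J hdiff L hLip
  have hI := newton_inv_bound J x0 β L hβpos hLpos hinv hβ hLip
  set X := newtonSeq F J x0 with hX
  have hX0 : X 0 = x0 := rfl
  have hXs : ∀ t, X (t + 1) = X t - (J (X t))⁻¹.mulVec (F (X t)) := fun t => rfl
  obtain ⟨s, hs0, hss⟩ : ∃ s : ℕ → ℝ, s 0 = 0 ∧ ∀ t, s (t + 1) =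
      s t + (β * L / 2 * s t ^ 2 - s t + η) / (1 - β * L * s t) :=
    ⟨fun t => (fun s : ℝ => s + (β * L / 2 * s ^ 2 - s + η) / (1 - β * L * s))^[t] 0, rfl,
      fun t => Function.iterate_succ_apply' _ _ _⟩
  have hsr : ∀ t, s t ≤ r := by
    intro t
    induction t with
    | zero => rw [hs0]; exact hr0
    | succ t ih => rw [hss]; exact (newton_scalar _ η r _ hβL har hroot ih).2
  have hsp : ∀ t, 0 < 1 - β * L * s t := fun t => by
    have := mul_le_mul_of_nonneg_left (hsr t) hβL.le
    linarith
  have hP : ∀ t, ‖X t - x0‖ ≤ s t ∧ ‖X (t + 1) - X t‖ ≤ s (t + 1) - s t ∧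
      (IsUnit (J (X t)) → ‖F (X (t + 1))‖ ≤ L / 2 * ‖X (t + 1) - X t‖ ^ 2) := by
    have hF : ∀ t, IsUnit (J (X t)) → ‖F (X (t + 1))‖ ≤ L / 2 * ‖X (t + 1) - X t‖ ^ 2 := by
      intro t hu
      have h1 := hT (X t) (X (t + 1))
      have h2 : (J (X t)).mulVec (X (t + 1) - X t) = - F (X t) := by
        rw [hXs, sub_sub_cancel_left, Matrix.mulVec_neg, Matrix.mulVec_mulVec,
          Matrix.mul_nonsing_inv _ ((Matrix.isUnit_iff_isUnit_det _).1 hu), Matrix.one_mulVec]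
      rw [h2] at h1
      simpa using h1
    intro t
    induction t with
    | zero =>
      refine ⟨by simp [hX0, hs0], ?_, hF 0⟩
      rw [hXs, hX0, hss, hs0]
      simpa using hη
    | succ t ih =>
      obtain ⟨h1, h2, _⟩ := ih
      have h3 : ‖X (t + 1) - x0‖ ≤ s (t + 1) := by
        calc ‖X (t + 1) - x0‖ = ‖(X (t + 1) - X t) + (X t - x0)‖ := by rw [sub_add_sub_cancel]
          _ ≤ _ := norm_add_le _ _
          _ ≤ _ := by linarith
      refine ⟨h3, ?_, hF _⟩
      have hf := hF t (hI _ _ h1 (hsp t)).1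
      have h4 := (hI _ _ h3 (hsp (t + 1))).2 (F (X (t + 1)))
      have e1 : ‖X (t + 1 + 1) - X (t + 1)‖ = ‖(J (X (t + 1)))⁻¹.mulVec (F (X (t + 1)))‖ := by
        rw [hXs (t + 1), sub_sub_cancel_left, norm_neg]
      rw [e1, hss (t + 1), add_sub_cancel_left]
      refine h4.trans ?_
      rw [div_mul_eq_mul_div]
      apply div_le_div_of_nonneg_right _ (hsp (t + 1)).le
      have e2 : β * L / 2 * s (t + 1) ^ 2 - s (t + 1) + η
          = β * L / 2 * (s (t + 1) - s t) ^ 2 := by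
        have h5 : (s (t + 1) - s t) * (1 - β * L * s t) = β * L / 2 * s t ^ 2 - s t + η := by
          rw [hss, add_sub_cancel_left, div_mul_cancel₀ _ (hsp t).ne']
        linear_combination -h5
      rw [e2]
      have h6 : ‖X (t + 1) - X t‖ ^ 2 ≤ (s (t + 1) - s t) ^ 2 :=
        pow_le_pow_left₀ (norm_nonneg _) h2 2
      calc β * ‖F (X (t + 1))‖ ≤ β * (L / 2 * (s (t + 1) - s t) ^ 2) := by
            refine mul_le_mul_of_nonneg_left (hf.trans ?_) hβpos.le
            exact mul_le_mul_of_nonneg_left h6 (by positivity)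
        _ = _ := by ring
  have hball : ∀ t, ‖X t - x0‖ ≤ r := fun t => (hP t).1.trans (hsr t)
  have hrp : 0 < 1 - β * L * r := by linarith
  have hunit : ∀ t, IsUnit (J (X t)) := fun t => (hI _ _ (hball t) hrp).1
  have hcau : CauchySeq X := by
    refine cauchySeq_of_dist_le_of_summable (fun t => s (t + 1) - s t) (fun t => ?_) ?_
    · rw [dist_comm, dist_eq_norm]; exact (hP t).2.1
    · refine summable_of_sum_range_le (c := r) (fun t => (norm_nonneg _).trans (hP t).2.1) ?_
      intro n
      rw [Finset.sum_range_sub, hs0, sub_zero]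
      exact hsr n
  obtain ⟨z, hz⟩ := cauchySeq_tendsto_of_complete hcau
  have hzball : ‖z - x0‖ ≤ r :=
    le_of_tendsto (hz.sub_const x0).norm (Eventually.of_forall hball)
  have hz1 : Tendsto (fun t => X (t + 1)) atTop (nhds z) := hz.comp (tendsto_add_atTop_nat 1)
  have hcont : Continuous F := continuous_iff_continuousAt.2 fun x => (hdiff x).continuousAt
  have hFz : F z = 0 := by
    have h1 : Tendsto (fun t => L / 2 * ‖X (t + 1) - X t‖ ^ 2) atTop (nhds 0) := by
      have := ((hz1.sub hz).norm.pow 2).const_mul (L / 2)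
      simpa using this
    have h2 : Tendsto (fun t => F (X (t + 1))) atTop (nhds 0) :=
      squeeze_zero_norm (fun t => (hP t).2.2 (hunit t)) h1
    exact tendsto_nhds_unique ((hcont.tendsto z).comp hz1) h2
  refine ⟨hunit, hball, z, hFz, hzball, ?_, hz, β / (1 - β * L * r) * (L / 2), by positivity, ?_⟩
  · intro y hy hFy
    have hmv := (convex_closedBall x0 r).norm_image_sub_le_of_norm_hasFDerivWithin_le'
      (f := F) (f' := fun x => LinearMap.toContinuousLinearMap (J x).mulVecLin) (C := L * r)
      (φ := LinearMap.toContinuousLinearMap (J x0).mulVecLin) (x := z) (y := y)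
      (fun x _ => (hdiff x).hasFDerivWithinAt)
      (by
        intro x hx
        refine ContinuousLinearMap.opNorm_le_bound _ (by positivity) fun v => ?_
        have e : (LinearMap.toContinuousLinearMap (J x).mulVecLin -
          LinearMap.toContinuousLinearMap (J x0).mulVecLin) v = (J x - J x0).mulVec v := by
          simp [Matrix.sub_mulVec]
        rw [e]
        refine (rowSum_mulVec_le _ _).trans (mul_le_mul_of_nonneg_right ?_ (norm_nonneg _))
        refine (hLip _ _).trans (mul_le_mul_of_nonneg_left ?_ hLpos.le)
        simpa [dist_eq_norm] using hx)
      (by simpa [dist_eq_norm] using hzball) (by simpa [dist_eq_norm] using hy)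
    have hmv2 : ‖(J x0).mulVec (y - z)‖ ≤ L * r * ‖y - z‖ := by
      rw [hFy, hFz, sub_zero, zero_sub, norm_neg] at hmv
      exact hmv
    have h1 := (rowSum_mulVec_le (J x0)⁻¹ ((J x0).mulVec (y - z)))
    rw [Matrix.mulVec_mulVec, Matrix.nonsing_inv_mul _ ((Matrix.isUnit_iff_isUnit_det _).1 hinv),
      Matrix.one_mulVec] at h1
    have h2 : ‖y - z‖ ≤ β * (L * r * ‖y - z‖) :=
      h1.trans (mul_le_mul hβ hmv2 (norm_nonneg _) hβpos.le)
    have : ‖y - z‖ = 0 := le_antisymm (by by_contra hc; push Not at hc; nlinarith) (norm_nonneg _)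
    exact sub_eq_zero.1 (norm_eq_zero.1 this)
  · intro t
    have e : X (t + 1) - z = (J (X t))⁻¹.mulVec (F z - F (X t) - (J (X t)).mulVec (z - X t)) := by
      rw [hFz, zero_sub, Matrix.mulVec_sub, Matrix.mulVec_mulVec,
        Matrix.nonsing_inv_mul _ ((Matrix.isUnit_iff_isUnit_det _).1 (hunit t)),
        Matrix.one_mulVec, Matrix.mulVec_neg, hXs]
      abel
    rw [e, mul_assoc, norm_sub_rev (X t) z]
    exact ((hI _ _ (hball t) hrp).2 _).trans
      (mul_le_mul_of_nonneg_left (hT _ _) (by positivity))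
end

section
/- Convergence conditions of Algorithm NR-loop (Theorem 3.2): Fix positive integers m, k, an integer ℓ, an m×k real matrix A with entries in {−1, 0, 1} such that for every c, Σ_{d=1}^k Σ_{e=1}^m |A_{ec}|·|A_{ed}| ≤ ℓ − k + 1, and ψ ∈ ℝ^m. Let q(x)_e = ψ_e + Σ_i A_{ei} x_i, F(x)_c = Σ_e A_{ec} q(x)_e |q(x)_e| and J(x)_{cd} = 2 Σ_e A_{ec} A_{ed} |q(x)_e|. Let x⁽⁰⁾ ∈ ℝ^k be such that J(x⁽⁰⁾) is invertible, and set β = ‖J(x⁽⁰⁾)⁻¹‖, η = ‖J(x⁽⁰⁾)⁻¹·F(x⁽⁰⁾)‖, L = 2k(ℓ − k + 1). If βηL < 1/2, then the Newton sequence x⁽ᵗ⁾ = x⁽ᵗ⁻¹⁾ − J(x⁽ᵗ⁻¹⁾)⁻¹·F(x⁽ᵗ⁻¹⁾) is well defined (each J(x⁽ᵗ⁾) is invertible) and converges to a point x* with F(x*) = 0, with quadratic order: there exists C ≥ 0 with ‖x⁽ᵗ⁾ − x*‖ ≤ C‖x⁽ᵗ⁻¹⁾ − x*‖² for all t ≥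 1. -/
open Matrix Filter

theorem nk_step {k : ℕ} (F : (Fin k → ℝ) → Fin k → ℝ)
    (J : (Fin k → ℝ) → Matrix (Fin k) (Fin k) ℝ) (L κ : ℝ) (hL : 0 ≤ L) (hκ : 0 < κ)
    (hlip : ∀ x y v, ‖(J y - J x) *ᵥ v‖ ≤ L * ‖y - x‖ * ‖v‖)
    (htay : ∀ x y, ‖F y - F x - J x *ᵥ (y - x)‖ ≤ L / 2 * ‖y - x‖ ^ 2)
    (x : Fin k → ℝ) (b : ℝ) (hb : 0 < b) (hu : IsUnit (J x))
    (hbv : ∀ v, ‖v‖ ≤ b * ‖J x *ᵥ v‖)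
    (hinvt : 2 * b * L * ‖(J x)⁻¹ *ᵥ F x‖ ≤ 1 - κ * b ^ 2)
    (y : Fin k → ℝ) (hy : y = x - (J x)⁻¹ *ᵥ F x) :
    ∃ b' : ℝ, 0 < b' ∧ IsUnit (J y) ∧ (∀ v, ‖v‖ ≤ b' * ‖J y *ᵥ v‖) ∧
      2 * b' * L * ‖(J y)⁻¹ *ᵥ F y‖ ≤ 1 - κ * b' ^ 2 ∧
      ‖(J y)⁻¹ *ᵥ F y‖ ≤ ‖(J x)⁻¹ *ᵥ F x‖ / 2 ∧
      ‖F y‖ ≤ L / 2 * ‖(J x)⁻¹ *ᵥ F x‖ ^ 2 := by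
  have hdet := (Matrix.isUnit_iff_isUnit_det _).1 hu
  have hxy : y - x = - ((J x)⁻¹ *ᵥ F x) := by rw [hy]; abel
  have hn : ‖y - x‖ = ‖(J x)⁻¹ *ᵥ F x‖ := by rw [hxy, norm_neg]
  have hFy : ‖F y‖ ≤ L / 2 * ‖(J x)⁻¹ *ᵥ F x‖ ^ 2 := by
    have := htay x y
    rw [hn, hxy, Matrix.mulVec_neg, Matrix.mulVec_mulVec, Matrix.mul_nonsing_inv _ hdet,
      Matrix.one_mulVec] at this
    simpa using this
  set s := ‖(J x)⁻¹ *ᵥ F x‖ with hs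
  have hs0 : 0 ≤ s := norm_nonneg _
  have hh0 : 0 ≤ b * L * s := by positivity
  have hκb : 0 < κ * b ^ 2 := by positivity
  obtain ⟨h, hh⟩ : ∃ h, h = b * L * s := ⟨_, rfl⟩
  have h0 : 0 ≤ h := hh ▸ hh0
  have h1 : κ * b ^ 2 ≤ 1 - 2 * h := by rw [hh]; linarith
  have h2 : h < 1 / 2 := by linarith
  have h3 : 0 < 1 - h := by linarith
  have hbv' : ∀ v, ‖v‖ ≤ b / (1 - h) * ‖J y *ᵥ v‖ := by
    intro v
    have e : J x *ᵥ v = J y *ᵥ v - (J y - J x) *ᵥ v := by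
      rw [Matrix.sub_mulVec]; abel
    have a1 := hbv v
    have a2 : ‖J x *ᵥ v‖ ≤ ‖J y *ᵥ v‖ + L * s * ‖v‖ := by
      rw [e]
      refine (norm_sub_le _ _).trans ?_
      have := hlip x y v
      rw [hn] at this
      linarith
    have a3 : b * ‖J x *ᵥ v‖ ≤ b * (‖J y *ᵥ v‖ + L * s * ‖v‖) :=
      mul_le_mul_of_nonneg_left a2 hb.le
    rw [div_mul_eq_mul_div, le_div_iff₀ h3]
    rw [hh]; nlinarith
  have hinj : Function.Injective (J y).mulVec := by
    intro u v huv
    have := hbv' (u - v)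
    rw [Matrix.mulVec_sub, show J y *ᵥ u = J y *ᵥ v from huv, sub_self, norm_zero, mul_zero] at this
    exact sub_eq_zero.1 (norm_le_zero_iff.1 this)
  have huy : IsUnit (J y) := Matrix.mulVec_injective_iff_isUnit.1 hinj
  have hdety := (Matrix.isUnit_iff_isUnit_det _).1 huy
  have hb' : 0 < b / (1 - h) := by positivity
  have hs' : ‖(J y)⁻¹ *ᵥ F y‖ ≤ b / (1 - h) * (L / 2 * s ^ 2) := by
    have := hbv' ((J y)⁻¹ *ᵥ F y)
    rw [Matrix.mulVec_mulVec, Matrix.mul_nonsing_inv _ hdety, Matrix.one_mulVec] at this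
    exact this.trans (mul_le_mul_of_nonneg_left hFy hb'.le)
  refine ⟨b / (1 - h), hb', huy, hbv', ?_, ?_, hFy⟩
  · have a1 : 2 * (b / (1 - h)) * L * ‖(J y)⁻¹ *ᵥ F y‖ ≤
      2 * (b / (1 - h)) * L * (b / (1 - h) * (L / 2 * s ^ 2)) :=
      mul_le_mul_of_nonneg_left hs' (by positivity)
    refine a1.trans ?_
    have e1 : 2 * (b / (1 - h)) * L * (b / (1 - h) * (L / 2 * s ^ 2)) = h ^ 2 / (1 - h) ^ 2 := by
      rw [div_mul_eq_mul_div, mul_div_assoc']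
      nth_rewrite 3 [hh]
      field_simp
    rw [e1, div_pow, mul_div_assoc', le_sub_iff_add_le, ← add_div, div_le_one (by positivity)]
    nlinarith
  · refine hs'.trans ?_
    rw [div_mul_eq_mul_div, div_le_iff₀ h3]
    have : b * (L / 2 * s ^ 2) = h * s / 2 := by rw [hh]; ring
    rw [this]
    nlinarith

theorem nk_main {k : ℕ} (F : (Fin k → ℝ) → Fin k → ℝ)
    (J : (Fin k → ℝ) → Matrix (Fin k) (Fin k) ℝ) (L κ : ℝ) (hL : 0 ≤ L) (hκ : 0 < κ)
    (hlip : ∀ x y v, ‖(J y - J x) *ᵥ v‖ ≤ L * ‖y - x‖ * ‖v‖)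
    (htay : ∀ x y, ‖F y - F x - J x *ᵥ (y - x)‖ ≤ L / 2 * ‖y - x‖ ^ 2)
    (hcont : Continuous F)
    (x0 : Fin k → ℝ) (b : ℝ) (hb : 0 < b) (hu : IsUnit (J x0))
    (hbv : ∀ v, ‖v‖ ≤ b * ‖J x0 *ᵥ v‖)
    (hinvt : 2 * b * L * ‖(J x0)⁻¹ *ᵥ F x0‖ ≤ 1 - κ * b ^ 2) :
    (∀ t, IsUnit (J (newtonSeq F J x0 t))) ∧
    ∃ xstar : Fin k → ℝ, F xstar = 0 ∧
      Tendsto (newtonSeq F J x0) atTop (nhds xstar) ∧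
      ∃ C : ℝ, 0 ≤ C ∧
        ∀ t : ℕ, ‖newtonSeq F J x0 (t + 1) - xstar‖ ≤ C * ‖newtonSeq F J x0 t - xstar‖ ^ 2 := by
  set X := newtonSeq F J x0 with hX
  have hstep : ∀ t, X (t + 1) = X t - (J (X t))⁻¹ *ᵥ F (X t) := fun t => rfl
  set η := ‖(J x0)⁻¹ *ᵥ F x0‖ with hη
  have key : ∀ t, ∃ b : ℝ, 0 < b ∧ IsUnit (J (X t)) ∧ (∀ v, ‖v‖ ≤ b * ‖J (X t) *ᵥ v‖) ∧
      2 * b * L * ‖(J (X t))⁻¹ *ᵥ F (X t)‖ ≤ 1 - κ * b ^ 2 ∧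
      ‖(J (X t))⁻¹ *ᵥ F (X t)‖ ≤ η * (1 / 2) ^ t := by
    intro t
    induction t with
    | zero => exact ⟨b, hb, hu, hbv, hinvt, by simp [hη, hX, newtonSeq]⟩
    | succ t ih =>
      obtain ⟨b, hb, hu, hbv, hi, hs⟩ := ih
      obtain ⟨b', h1, h2, h3, h4, h5, -⟩ :=
        nk_step F J L κ hL hκ hlip htay (X t) b hb hu hbv hi (X (t + 1)) (hstep t)
      refine ⟨b', h1, h2, h3, h4, h5.trans ?_⟩
      rw [pow_succ]; linarith
  have hFb : ∀ t, ‖F (X (t + 1))‖ ≤ L / 2 * (η * (1 / 2) ^ t) ^ 2 := by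
    intro t
    obtain ⟨b, hb, hu, hbv, hi, hs⟩ := key t
    obtain ⟨b', h1, h2, h3, h4, h5, h6⟩ :=
        nk_step F J L κ hL hκ hlip htay (X t) b hb hu hbv hi (X (t + 1)) (hstep t)
    refine h6.trans ?_
    gcongr
  have hcau : CauchySeq X := by
    refine cauchySeq_of_le_geometric (1 / 2) η (by norm_num) ?_
    intro n
    obtain ⟨b, hb, hu, hbv, hi, hs⟩ := key n
    rw [hstep, dist_eq_norm]
    simpa using hs
  obtain ⟨xs, hxs⟩ := cauchySeq_tendsto_of_complete hcau
  have hF0 : F xs = 0 := by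
    have t1 : Tendsto (fun t => F (X (t + 1))) atTop (nhds (F xs)) :=
      (hcont.tendsto xs).comp ((tendsto_add_atTop_iff_nat 1).2 hxs)
    have t2 : Tendsto (fun t : ℕ => L / 2 * (η * (1 / 2 : ℝ) ^ t) ^ 2) atTop (nhds 0) := by
      have := tendsto_pow_atTop_nhds_zero_of_lt_one (r := (1 / 2 : ℝ)) (by norm_num) (by norm_num)
      simpa using ((this.const_mul η).pow 2).const_mul (L / 2)
    exact tendsto_nhds_unique t1 (squeeze_zero_norm hFb t2)
  refine ⟨fun t => (key t).choose_spec.2.1, xs, hF0, hxs,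
    (κ⁻¹ + 1) * (L / 2), by positivity, ?_⟩
  intro t
  obtain ⟨b, hb, hu, hbv, hi, hs⟩ := key t
  have hdet := (Matrix.isUnit_iff_isUnit_det _).1 hu
  have hbb : b ≤ κ⁻¹ + 1 := by
    have : 0 ≤ 2 * b * L * ‖(J (X t))⁻¹ *ᵥ F (X t)‖ := by positivity
    have h1 : b ^ 2 ≤ κ⁻¹ := by
      rw [inv_eq_one_div, le_div_iff₀ hκ]; linarith
    nlinarith [sq_nonneg (b - 1)]
  have e : J (X t) *ᵥ (X (t + 1) - xs) = F xs - F (X t) - J (X t) *ᵥ (xs - X t) := by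
    rw [hstep, hF0, Matrix.mulVec_sub, Matrix.mulVec_sub, Matrix.mulVec_sub,
      Matrix.mulVec_mulVec, Matrix.mul_nonsing_inv _ hdet, Matrix.one_mulVec]
    abel
  have a := hbv (X (t + 1) - xs)
  rw [e] at a
  have a2 := htay (X t) xs
  rw [norm_sub_rev xs] at a2
  calc _ ≤ _ := a
    _ ≤ (κ⁻¹ + 1) * (L / 2 * ‖X t - xs‖ ^ 2) := by gcongr
    _ = _ := by ring

theorem rowSumNorm_mulVec {k : ℕ} (M : Matrix (Fin k) (Fin k) ℝ) (v : Fin k → ℝ) :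
    ‖M *ᵥ v‖ ≤ rowSumNorm M * ‖v‖ := by
  have h0 : 0 ≤ rowSumNorm M := Real.iSup_nonneg fun c => Finset.sum_nonneg fun d _ => abs_nonneg _
  refine (pi_norm_le_iff_of_nonneg (by positivity)).2 fun c => ?_
  have h1 : ∑ d, |M c d| ≤ rowSumNorm M :=
    le_ciSup (f := fun c => ∑ d, |M c d|) (Set.finite_range _).bddAbove c
  calc ‖(M *ᵥ v) c‖ ≤ ∑ d, ‖M c d * v d‖ := norm_sum_le Finset.univ (fun d => M c d * v d)
    _ ≤ ∑ d, |M c d| * ‖v‖ := by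
      refine Finset.sum_le_sum fun d _ => ?_
      rw [norm_mul, Real.norm_eq_abs]
      exact mul_le_mul_of_nonneg_left (norm_le_pi_norm v d) (abs_nonneg _)
    _ = (∑ d, |M c d|) * ‖v‖ := by rw [Finset.sum_mul]
    _ ≤ _ := by gcongr

theorem abs_taylor (a b : ℝ) : |b * |b| - a * |a| - 2 * |a| * (b - a)| ≤ (b - a) ^ 2 := by
  rw [abs_le]
  rcases abs_cases a with ⟨h1, h2⟩ | ⟨h1, h2⟩ <;> rcases abs_cases b with ⟨h3, h4⟩ | ⟨h3, h4⟩ <;>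
    rw [h1, h3] <;> constructor <;> nlinarith

/-- Theorem 3.2 (convergence conditions of Algorithm NR-loop): for the loop error function
`F(x)_c = Σ_e A_{ec} q(x)_e |q(x)_e|` with Jacobian `J(x)_{cd} = 2 Σ_e A_{ec} A_{ed} |q(x)_e|`,
where `A` has entries in `{-1,0,1}` and satisfies the combinatorial bound
`Σ_d Σ_e |A_{ec}||A_{ed}| ≤ ℓ - k + 1`, if `J(x⁽⁰⁾)` is invertible,
`β = ‖J(x⁽⁰⁾)⁻¹‖`, `η = ‖J(x⁽⁰⁾)⁻¹ F(x⁽⁰⁾)‖`, `L = 2k(ℓ - k + 1)` and `βηL < 1/2`,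
then the Newton sequence is well defined and converges to a zero of `F` with quadratic order. -/
theorem nrLoop_convergence {m k : ℕ} (hm : 0 < m) (hk : 0 < k) (ℓ : ℤ)
    (A : Matrix (Fin m) (Fin k) ℝ)
    (hA : ∀ e c, A e c = -1 ∨ A e c = 0 ∨ A e c = 1)
    (hcol : ∀ c, ∑ d, ∑ e, |A e c| * |A e d| ≤ (ℓ : ℝ) - k + 1)
    (ψ : Fin m → ℝ)
    (q : (Fin k → ℝ) → Fin m → ℝ)
    (hq : ∀ x e, q x e = ψ e + ∑ i, A e i * x i)
    (F : (Fin k → ℝ) → Fin k → ℝ)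
    (hF : ∀ x c, F x c = ∑ e, A e c * (q x e * |q x e|))
    (J : (Fin k → ℝ) → Matrix (Fin k) (Fin k) ℝ)
    (hJ : ∀ x c d, J x c d = 2 * ∑ e, A e c * A e d * |q x e|)
    (x0 : Fin k → ℝ) (hinv : IsUnit (J x0))
    (β η L : ℝ)
    (hβ : β = rowSumNorm (J x0)⁻¹)
    (hη : η = ‖(J x0)⁻¹.mulVec (F x0)‖)
    (hL : L = 2 * k * ((ℓ : ℝ) - k + 1))
    (hh : β * η * L < 1 / 2) :
    (∀ t, IsUnit (J (newtonSeq F J x0 t))) ∧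
    ∃ xstar : Fin k → ℝ, F xstar = 0 ∧
      Tendsto (newtonSeq F J x0) atTop (nhds xstar) ∧
      ∃ C : ℝ, 0 ≤ C ∧
        ∀ t : ℕ, ‖newtonSeq F J x0 (t + 1) - xstar‖ ≤ C * ‖newtonSeq F J x0 t - xstar‖ ^ 2 := by
  have hA1 : ∀ e c, |A e c| ≤ 1 := by
    intro e c
    rcases hA e c with h | h | h <;> rw [h] <;> norm_num
  obtain ⟨N, hN⟩ : ∃ N : ℝ, N = (ℓ : ℝ) - k + 1 := ⟨_, rfl⟩
  rw [← hN] at hL hcol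
  have hcol' : ∀ c, ∑ e, |A e c| * ∑ d, |A e d| ≤ N := by
    intro c
    refine le_trans (le_of_eq ?_) (hcol c)
    rw [Finset.sum_comm]
    exact Finset.sum_congr rfl fun e _ => Finset.mul_sum _ _ _
  have hN0 : 0 ≤ N := (Finset.sum_nonneg fun d _ => Finset.sum_nonneg fun e _ => by positivity).trans
    (hcol ⟨0, hk⟩)
  have hL0 : 0 ≤ L := by rw [hL]; positivity
  have hs : ∀ e, ∑ d, |A e d| ≤ k := by
    intro e
    calc ∑ d, |A e d| ≤ ∑ d : Fin k, (1 : ℝ) := Finset.sum_le_sum fun d _ => hA1 e d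
      _ = k := by simp
  have hlin : ∀ e (v : Fin k → ℝ), |∑ i, A e i * v i| ≤ (∑ d, |A e d|) * ‖v‖ := by
    intro e v
    rw [Finset.sum_mul]
    refine (Finset.abs_sum_le_sum_abs _ _).trans (Finset.sum_le_sum fun i _ => ?_)
    rw [abs_mul]
    exact mul_le_mul_of_nonneg_left (norm_le_pi_norm v i) (abs_nonneg _)
  have hqd : ∀ x y e, q y e - q x e = ∑ i, A e i * (y - x) i := by
    intro x y e
    rw [hq, hq]
    simp only [Pi.sub_apply, mul_sub, Finset.sum_sub_distrib]
    ring
  have hJv : ∀ x v c, (J x *ᵥ v) c = ∑ e, A e c * (2 * |q x e| * ∑ d, A e d * v d) := by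
    intro x v c
    simp only [Matrix.mulVec, dotProduct, hJ, Finset.mul_sum, Finset.sum_mul]
    rw [Finset.sum_comm]
    refine Finset.sum_congr rfl fun e _ => Finset.sum_congr rfl fun d _ => by ring
  have hlip : ∀ x y v, ‖(J y - J x) *ᵥ v‖ ≤ L * ‖y - x‖ * ‖v‖ := by
    intro x y v
    refine (pi_norm_le_iff_of_nonneg (by positivity)).2 fun c => ?_
    rw [Matrix.sub_mulVec, Pi.sub_apply, hJv, hJv, ← Finset.sum_sub_distrib, Real.norm_eq_abs]
    refine (Finset.abs_sum_le_sum_abs _ _).trans ?_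
    calc _ ≤ ∑ e, (|A e c| * ∑ d, |A e d|) * (2 * k * ‖y - x‖ * ‖v‖) := by
          refine Finset.sum_le_sum fun e _ => ?_
          rw [show A e c * (2 * |q y e| * ∑ d, A e d * v d) - A e c * (2 * |q x e| * ∑ d, A e d * v d)
            = A e c * (2 * (|q y e| - |q x e|) * ∑ d, A e d * v d) by ring,
            abs_mul, abs_mul, abs_mul, abs_two]
          have b1 : |(|q y e| - |q x e|)| ≤ k * ‖y - x‖ := by
            refine (abs_abs_sub_abs_le _ _).trans ?_
            rw [hqd]
            exact (hlin e _).trans (mul_le_mul_of_nonneg_right (hs e) (norm_nonneg _))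
          calc _ ≤ |A e c| * (2 * (k * ‖y - x‖) * ((∑ d, |A e d|) * ‖v‖)) := by
                gcongr
                exact hlin e v
            _ = _ := by ring
      _ = (∑ e, |A e c| * ∑ d, |A e d|) * (2 * k * ‖y - x‖ * ‖v‖) := by rw [Finset.sum_mul]
      _ ≤ N * (2 * k * ‖y - x‖ * ‖v‖) := by gcongr; exact hcol' c
      _ = _ := by rw [hL]; ring
  have htay : ∀ x y, ‖F y - F x - J x *ᵥ (y - x)‖ ≤ L / 2 * ‖y - x‖ ^ 2 := by
    intro x y
    refine (pi_norm_le_iff_of_nonneg (by positivity)).2 fun c => ?_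
    rw [Pi.sub_apply, Pi.sub_apply, hJv, hF, hF, ← Finset.sum_sub_distrib,
      ← Finset.sum_sub_distrib, Real.norm_eq_abs]
    refine (Finset.abs_sum_le_sum_abs _ _).trans ?_
    calc _ ≤ ∑ e, (|A e c| * ∑ d, |A e d|) * (k * ‖y - x‖ ^ 2) := by
          refine Finset.sum_le_sum fun e _ => ?_
          rw [← hqd, ← mul_sub, ← mul_sub, abs_mul, mul_assoc (|A e c|)]
          refine mul_le_mul_of_nonneg_left ?_ (abs_nonneg (A e c))
          refine (abs_taylor _ _).trans ?_
          have b1 := hlin e (y - x)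
          rw [← hqd] at b1
          have h0 : 0 ≤ ∑ d, |A e d| := by positivity
          calc (q y e - q x e) ^ 2 = |q y e - q x e| ^ 2 := (sq_abs _).symm
            _ ≤ ((∑ d, |A e d|) * ‖y - x‖) ^ 2 := by gcongr
            _ = (∑ d, |A e d|) * ((∑ d, |A e d|) * ‖y - x‖ ^ 2) := by ring
            _ ≤ _ := by gcongr; exact hs e
      _ = (∑ e, |A e c| * ∑ d, |A e d|) * (k * ‖y - x‖ ^ 2) := by rw [Finset.sum_mul]
      _ ≤ N * (k * ‖y - x‖ ^ 2) := by gcongr; exact hcol' c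
      _ = _ := by rw [hL]; ring
  have hcont : Continuous F := by
    have : F = fun x c => ∑ e, A e c * ((ψ e + ∑ i, A e i * x i) * |ψ e + ∑ i, A e i * x i|) := by
      funext x c; rw [hF]; simp only [hq]
    rw [this]
    fun_prop
  have hdet := (Matrix.isUnit_iff_isUnit_det _).1 hinv
  have hbv : ∀ v, ‖v‖ ≤ β * ‖J x0 *ᵥ v‖ := by
    intro v
    have := rowSumNorm_mulVec (J x0)⁻¹ (J x0 *ᵥ v)
    rwa [Matrix.mulVec_mulVec, Matrix.nonsing_inv_mul _ hdet, Matrix.one_mulVec, ← hβ] at this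
  have hβ0 : 0 < β := by
    have h1 := hbv (fun _ => 1)
    have h2 : (1 : ℝ) ≤ ‖(fun _ => 1 : Fin k → ℝ)‖ := by
      simpa using norm_le_pi_norm (fun _ => 1 : Fin k → ℝ) ⟨0, hk⟩
    by_contra hc
    have := mul_nonpos_of_nonpos_of_nonneg (not_lt.1 hc)
      (norm_nonneg (J x0 *ᵥ (fun _ => 1 : Fin k → ℝ)))
    linarith
  refine nk_main F J L ((1 - 2 * (β * η * L)) / β ^ 2) hL0 (div_pos (by linarith) (by positivity))
    hlip htay hcont x0 β hβ0 hinv hbv ?_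
  rw [← hη, div_mul_cancel₀ _ (by positivity)]
  linarith
end

section
/- Improved Lipschitz constant for planar graphs (bound L ≤ 8n): Fix positive integers m, k, n and an m×k real matrix A with entries in {−1, 0, 1} such that every row has at most two nonzero entries (Σ_{i=1}^k |A_{ei}| ≤ 2 for every e) and every column has at most n nonzero entries (Σ_{e=1}^m A_{ec}² ≤ n for every c). Fix ψ ∈ ℝ^m, let q(x)_e = ψ_e + Σ_i A_{ei} x_i and J(x)_{cd} = 2 Σ_e A_{ec} A_{ed} |q(x)_e|. Then for all x, y ∈ ℝ^k: ‖J(x) − J(y)‖ ≤ 8n·‖x − y‖, where ‖·‖ denotes the sup norm on ℝ^k and the maximum-absolute-row-sum norm on k×k matrices. -/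
open Matrix

/-- Improved Lipschitz constant for planar graphs (`L ≤ 8n`): if `A` has entries in
`{-1,0,1}`, every row has at most two nonzero entries (each edge lies on at most two faces)
and every column has at most `n` nonzero entries (each face cycle has at most `n` edges),
then the Jacobian `J(x)_{cd} = 2 Σ_e A_{ec} A_{ed} |q(x)_e|` satisfies
`‖J(x) - J(y)‖ ≤ 8n‖x - y‖` (sup norm on `ℝ^k`, max absolute row sum norm on matrices). -/
theorem jacobian_lipschitz_planar {m k n : ℕ} (hm : 0 < m) (hk : 0 < k) (hn : 0 < n)
    (A : Matrix (Fin m) (Fin k) ℝ)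
    (hA : ∀ e c, A e c = -1 ∨ A e c = 0 ∨ A e c = 1)
    (hrow : ∀ e, ∑ i, |A e i| ≤ 2)
    (hcolsq : ∀ c, ∑ e, (A e c) ^ 2 ≤ (n : ℝ))
    (ψ : Fin m → ℝ)
    (q : (Fin k → ℝ) → Fin m → ℝ)
    (hq : ∀ x e, q x e = ψ e + ∑ i, A e i * x i)
    (J : (Fin k → ℝ) → Matrix (Fin k) (Fin k) ℝ)
    (hJ : ∀ x c d, J x c d = 2 * ∑ e, A e c * A e d * |q x e|)
    (x y : Fin k → ℝ) :
    rowSumNorm (J x - J y) ≤ 8 * n * ‖x - y‖ := by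
  have hD : 0 ≤ ‖x - y‖ := norm_nonneg _
  have hqd : ∀ e, |(|q x e| - |q y e|)| ≤ 2 * ‖x - y‖ := by
    intro e
    refine (abs_abs_sub_abs_le_abs_sub _ _).trans ?_
    have h1 : q x e - q y e = ∑ i, A e i * (x - y) i := by
      rw [hq, hq, add_sub_add_left_eq_sub, ← Finset.sum_sub_distrib]
      exact Finset.sum_congr rfl fun i _ => by rw [Pi.sub_apply]; ring
    rw [h1]
    calc |∑ i, A e i * (x - y) i| ≤ ∑ i, |A e i * (x - y) i| := Finset.abs_sum_le_sum_abs _ _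
      _ ≤ ∑ i, |A e i| * ‖x - y‖ := Finset.sum_le_sum fun i _ => by
          rw [abs_mul]
          exact mul_le_mul_of_nonneg_left (norm_le_pi_norm (x - y) i) (abs_nonneg _)
      _ = (∑ i, |A e i|) * ‖x - y‖ := by rw [Finset.sum_mul]
      _ ≤ 2 * ‖x - y‖ := mul_le_mul_of_nonneg_right (hrow e) hD
  have habs : ∀ e c, |A e c| = (A e c) ^ 2 := by
    intro e c
    rcases hA e c with h | h | h <;> rw [h] <;> norm_num
  haveI : Nonempty (Fin k) := ⟨⟨0, hk⟩⟩
  unfold rowSumNorm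
  refine ciSup_le fun c => ?_
  have hent : ∀ d, |(J x - J y) c d| ≤ ∑ e, 4 * ‖x - y‖ * (|A e c| * |A e d|) := by
    intro d
    have h2 : (J x - J y) c d = ∑ e, 2 * (A e c * A e d * (|q x e| - |q y e|)) := by
      rw [Matrix.sub_apply, hJ, hJ, ← mul_sub, ← Finset.sum_sub_distrib, Finset.mul_sum]
      exact Finset.sum_congr rfl fun e _ => by ring
    rw [h2]
    refine (Finset.abs_sum_le_sum_abs _ _).trans (Finset.sum_le_sum fun e _ => ?_)
    rw [abs_mul, abs_mul, abs_mul, abs_two]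
    have h3 := mul_le_mul_of_nonneg_left (hqd e)
      (mul_nonneg (abs_nonneg (A e c)) (abs_nonneg (A e d)))
    linarith
  calc ∑ d, |(J x - J y) c d| ≤ ∑ d, ∑ e, 4 * ‖x - y‖ * (|A e c| * |A e d|) :=
        Finset.sum_le_sum fun d _ => hent d
    _ = ∑ e, 4 * ‖x - y‖ * (|A e c| * ∑ d, |A e d|) := by
        rw [Finset.sum_comm]
        exact Finset.sum_congr rfl fun e _ => by rw [Finset.mul_sum, Finset.mul_sum]
    _ ≤ ∑ e, 4 * ‖x - y‖ * ((A e c) ^ 2 * 2) := Finset.sum_le_sum fun e _ => by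
        rw [← habs]
        exact mul_le_mul_of_nonneg_left
          (mul_le_mul_of_nonneg_left (hrow e) (abs_nonneg _)) (by positivity)
    _ = 8 * (∑ e, (A e c) ^ 2) * ‖x - y‖ := by
        rw [Finset.mul_sum, Finset.sum_mul]
        exact Finset.sum_congr rfl fun e _ => by ring
    _ ≤ 8 * n * ‖x - y‖ :=
        mul_le_mul_of_nonneg_right (mul_le_mul_of_nonneg_left (hcolsq c) (by norm_num)) hD
end

section
/- Diagonal dominance of the Jacobian for face cycle bases: Fix positive integers m, k and an m×k real matrix A with entries in {−1, 0, 1} such that Σ_{i=1}^k |A_{ei}| ≤ 2 for every row e. Fix ψ ∈ ℝ^m, let q(x)_e = ψ_e + Σ_i A_{ei} x_i and J(x)_{cd} = 2 Σ_e A_{ec} A_{ed} |q(x)_e|. Then for every x ∈ ℝ^k and every index c: Σ_{d ≠ c} |J(x)_{cd}| ≤ J(x)_{cc}. -/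
open Matrix

/-- Diagonal dominance of the Jacobian for face cycle bases: if `A` has entries in
`{-1,0,1}` and every row of `A` has at most two nonzero entries (each edge lies on at most
two faces), then for the Jacobian `J(x)_{cd} = 2 Σ_e A_{ec} A_{ed} |q(x)_e|` of the loop
error function one has `Σ_{d ≠ c} |J(x)_{cd}| ≤ J(x)_{cc}` for every `x` and `c`. -/
theorem jacobian_diagonally_dominant {m k : ℕ} (hm : 0 < m) (hk : 0 < k)
    (A : Matrix (Fin m) (Fin k) ℝ)
    (hA : ∀ e c, A e c = -1 ∨ A e c = 0 ∨ A e c = 1)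
    (hrow : ∀ e, ∑ i, |A e i| ≤ 2)
    (ψ : Fin m → ℝ)
    (q : (Fin k → ℝ) → Fin m → ℝ)
    (hq : ∀ x e, q x e = ψ e + ∑ i, A e i * x i)
    (J : (Fin k → ℝ) → Matrix (Fin k) (Fin k) ℝ)
    (hJ : ∀ x c d, J x c d = 2 * ∑ e, A e c * A e d * |q x e|)
    (x : Fin k → ℝ) (c : Fin k) :
    ∑ d ∈ Finset.univ.erase c, |J x c d| ≤ J x c c := by
  have key : ∀ e, ∑ d ∈ Finset.univ.erase c, abs (A e c * A e d * |q x e|) ≤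
      A e c * A e c * |q x e| := by
    intro e
    have h1 : ∑ d ∈ Finset.univ.erase c, |A e d| + |A e c| ≤ 2 := by
      rw [Finset.sum_erase_add _ _ (Finset.mem_univ c)]
      exact hrow e
    have h2 : ∑ d ∈ Finset.univ.erase c, abs (A e c * A e d * |q x e|) =
        |A e c| * |q x e| * ∑ d ∈ Finset.univ.erase c, |A e d| := by
      rw [Finset.mul_sum]
      refine Finset.sum_congr rfl fun d _ => ?_
      rw [abs_mul, abs_mul, abs_abs]
      ring
    rw [h2]
    have h3 := abs_nonneg (q x e)
    rcases hA e c with h | h | h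
    · rw [h] at h1 ⊢
      norm_num at h1 ⊢
      nlinarith
    · simp [h]
    · rw [h] at h1 ⊢
      norm_num at h1 ⊢
      nlinarith
  calc ∑ d ∈ Finset.univ.erase c, |J x c d|
      ≤ ∑ d ∈ Finset.univ.erase c, 2 * ∑ e, abs (A e c * A e d * |q x e|) := by
        refine Finset.sum_le_sum fun d _ => ?_
        rw [hJ, abs_mul, abs_two]
        exact mul_le_mul_of_nonneg_left (Finset.abs_sum_le_sum_abs _ _) (by norm_num)
    _ = 2 * ∑ e, ∑ d ∈ Finset.univ.erase c, abs (A e c * A e d * |q x e|) := by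
        rw [← Finset.mul_sum, Finset.sum_comm]
    _ ≤ J x c c := by
        rw [hJ]
        exact mul_le_mul_of_nonneg_left (Finset.sum_le_sum fun e _ => key e) (by norm_num)
end

section
/- Lipschitz bound for the diagonal approximation H (Claim 4.2): Fix positive integers m, k and an integer ℓ. Let A be an m×k real matrix with entries in {−1, 0, 1} such that for every column c, Σ_{e=1}^m Σ_{i=1}^k A_{ec}²·|A_{ei}| ≤ ℓ − k + 1. Fix ψ ∈ ℝ^m, let q(x)_e = ψ_e + Σ_i A_{ei} x_i, and let H(x) be the k×k diagonal matrix with H(x)_{cc} = 2 Σ_{e=1}^m A_{ec}² |q(x)_e|. Then for all x, x⁽⁰⁾ ∈ ℝ^k: ‖H(x) − H(x⁽⁰⁾)‖ ≤ 2(ℓ − k + 1)·‖x − x⁽⁰⁾‖, with the sup norm on ℝ^k and the maximum-absolute-row-sum norm on matrices. -/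
open Matrix

/-- Claim 4.2 (Lipschitz bound for the diagonal approximation `H`): if `A` has entries in
`{-1,0,1}` and `Σ_e Σ_i A_{ec}²|A_{ei}| ≤ ℓ - k + 1` for every column `c`, then the diagonal
matrix `H(x)` with entries `H(x)_{cc} = 2 Σ_e A_{ec}² |q(x)_e|` satisfies
`‖H(x) - H(x⁽⁰⁾)‖ ≤ 2(ℓ - k + 1)‖x - x⁽⁰⁾‖` (sup norm on `ℝ^k`, max absolute row sum norm
on matrices). -/
theorem hc_diag_lipschitz {m k : ℕ} (hm : 0 < m) (hk : 0 < k) (ℓ : ℤ)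
    (A : Matrix (Fin m) (Fin k) ℝ)
    (hA : ∀ e c, A e c = -1 ∨ A e c = 0 ∨ A e c = 1)
    (hcol : ∀ c, ∑ e, ∑ i, (A e c) ^ 2 * |A e i| ≤ (ℓ : ℝ) - k + 1)
    (ψ : Fin m → ℝ)
    (q : (Fin k → ℝ) → Fin m → ℝ)
    (hq : ∀ x e, q x e = ψ e + ∑ i, A e i * x i)
    (H : (Fin k → ℝ) → Matrix (Fin k) (Fin k) ℝ)
    (hH : ∀ x, H x = Matrix.diagonal fun c => 2 * ∑ e, (A e c) ^ 2 * |q x e|)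
    (x x0 : Fin k → ℝ) :
    rowSumNorm (H x - H x0) ≤ 2 * ((ℓ : ℝ) - k + 1) * ‖x - x0‖ := by
  have : Nonempty (Fin k) := ⟨⟨0, hk⟩⟩
  unfold rowSumNorm
  refine ciSup_le fun c => ?_
  have hrow : ∑ d, |(H x - H x0) c d|
      = |(2 * ∑ e, (A e c) ^ 2 * |q x e|) - (2 * ∑ e, (A e c) ^ 2 * |q x0 e|)| := by
    rw [hH, hH, Finset.sum_eq_single c]
    · simp
    · intro d _ hd
      simp [Matrix.diagonal_apply_ne _ hd.symm]
    · simp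
  have hqe : ∀ e, |(|q x e| - |q x0 e|)| ≤ ∑ i, |A e i| * ‖x - x0‖ := by
    intro e
    refine (abs_abs_sub_abs_le_abs_sub _ _).trans ?_
    have h1 : q x e - q x0 e = ∑ i, A e i * (x - x0) i := by
      simp only [hq, Pi.sub_apply, mul_sub, Finset.sum_sub_distrib]
      ring
    rw [h1]
    refine (Finset.abs_sum_le_sum_abs _ _).trans (Finset.sum_le_sum fun i _ => ?_)
    rw [abs_mul]
    exact mul_le_mul_of_nonneg_left (norm_le_pi_norm (x - x0) i) (abs_nonneg _)
  rw [hrow, ← mul_sub, ← Finset.sum_sub_distrib, abs_mul, abs_two, mul_assoc]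
  refine mul_le_mul_of_nonneg_left ?_ zero_le_two
  calc |∑ e, ((A e c) ^ 2 * |q x e| - (A e c) ^ 2 * |q x0 e|)|
      ≤ ∑ e, |((A e c) ^ 2 * |q x e| - (A e c) ^ 2 * |q x0 e|)| :=
        Finset.abs_sum_le_sum_abs _ _
    _ ≤ ∑ e, (A e c) ^ 2 * ∑ i, |A e i| * ‖x - x0‖ := by
        refine Finset.sum_le_sum fun e _ => ?_
        rw [← mul_sub, abs_mul, abs_of_nonneg (sq_nonneg (A e c))]
        exact mul_le_mul_of_nonneg_left (hqe e) (sq_nonneg _)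
    _ = (∑ e, ∑ i, (A e c) ^ 2 * |A e i|) * ‖x - x0‖ := by
        simp only [Finset.sum_mul, Finset.mul_sum, mul_assoc]
    _ ≤ ((ℓ : ℝ) - k + 1) * ‖x - x0‖ :=
        mul_le_mul_of_nonneg_right (hcol c) (norm_nonneg _)
end

section
/- Bound on the deviation of H from the Jacobian (Claim 4.3): Fix positive integers m, k and an integer ℓ. Let A be an m×k real matrix with entries in {−1, 0, 1} such that for every column c, Σ_{d ≠ c} Σ_{e=1}^m |A_{ec}|·|A_{ed}| ≤ ℓ − k − 2. Fix ψ ∈ ℝ^m and x⁽⁰⁾ ∈ ℝ^k, set ψ_max = max_e |ψ_e|, let q(x)_e = ψ_e + Σ_i A_{ei} x_i, let J(x)_{cd} = 2 Σ_e A_{ec} A_{ed} |q(x)_e| and let H(x) be the diagonal matrix with entries J(x)_{cc}. Then for all x ∈ ℝ^k: ‖J(x) − H(x)‖ ≤ δ₀ + δ₁‖x − x⁽⁰⁾‖, where δ₀ = 2(ℓ − k − 2)·(ψ_max + k‖x⁽⁰⁾‖) and δ₁ = 2k(ℓ − k − 2), with the sup norm on ℝ^k and the maximum-absolute-row-sum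 norm on matrices. -/
open Matrix

/-- Claim 4.3 (bound on the deviation of `H` from the Jacobian): if `A` has entries in
`{-1,0,1}` and `Σ_{d≠c} Σ_e |A_{ec}||A_{ed}| ≤ ℓ - k - 2` for every column `c`, then the
Jacobian `J(x)_{cd} = 2 Σ_e A_{ec} A_{ed} |q(x)_e|` and its diagonal part `H(x)` satisfy
`‖J(x) - H(x)‖ ≤ δ₀ + δ₁‖x - x⁽⁰⁾‖` where `δ₀ = 2(ℓ-k-2)(ψ_max + k‖x⁽⁰⁾‖)` and
`δ₁ = 2k(ℓ-k-2)`, with `ψ_max = max_e |ψ_e|`. -/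
theorem hc_deviation_bound {m k : ℕ} (hm : 0 < m) (hk : 0 < k) (ℓ : ℤ)
    (A : Matrix (Fin m) (Fin k) ℝ)
    (hA : ∀ e c, A e c = -1 ∨ A e c = 0 ∨ A e c = 1)
    (hcol : ∀ c, ∑ d ∈ Finset.univ.erase c, ∑ e, |A e c| * |A e d| ≤ (ℓ : ℝ) - k - 2)
    (ψ : Fin m → ℝ) (x0 : Fin k → ℝ)
    (ψmax : ℝ) (hψmax : ψmax = ⨆ e, |ψ e|)
    (q : (Fin k → ℝ) → Fin m → ℝ)
    (hq : ∀ x e, q x e = ψ e + ∑ i, A e i * x i)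
    (J : (Fin k → ℝ) → Matrix (Fin k) (Fin k) ℝ)
    (hJ : ∀ x c d, J x c d = 2 * ∑ e, A e c * A e d * |q x e|)
    (H : (Fin k → ℝ) → Matrix (Fin k) (Fin k) ℝ)
    (hH : ∀ x, H x = Matrix.diagonal fun c => J x c c)
    (δ₀ δ₁ : ℝ)
    (hδ₀ : δ₀ = 2 * ((ℓ : ℝ) - k - 2) * (ψmax + k * ‖x0‖))
    (hδ₁ : δ₁ = 2 * k * ((ℓ : ℝ) - k - 2))
    (x : Fin k → ℝ) :
    rowSumNorm (J x - H x) ≤ δ₀ + δ₁ * ‖x - x0‖ := by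
  haveI : Nonempty (Fin k) := ⟨⟨0, hk⟩⟩
  have hA1 : ∀ e c, |A e c| ≤ 1 := by
    intro e c
    rcases hA e c with h | h | h <;> simp [h]
  set B : ℝ := ψmax + k * ‖x0‖ + k * ‖x - x0‖ with hB
  have hxn : ‖x‖ ≤ ‖x0‖ + ‖x - x0‖ := by
    have h := norm_add_le x0 (x - x0)
    rwa [add_sub_cancel] at h
  have hqB : ∀ e, |q x e| ≤ B := by
    intro e
    have h1 : |ψ e| ≤ ψmax := by
      rw [hψmax]
      exact le_ciSup (f := fun e => |ψ e|) (Set.finite_range _).bddAbove e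
    have h2 : |∑ i, A e i * x i| ≤ k * ‖x‖ := by
      calc |∑ i, A e i * x i| ≤ ∑ i, |A e i * x i| := Finset.abs_sum_le_sum_abs _ _
        _ ≤ ∑ _i : Fin k, ‖x‖ := by
          refine Finset.sum_le_sum fun i _ => ?_
          rw [abs_mul]
          have h3 : |x i| ≤ ‖x‖ := norm_le_pi_norm x i
          have := mul_le_mul (hA1 e i) h3 (abs_nonneg _) zero_le_one
          linarith
        _ = k * ‖x‖ := by simp
    have h4 : (k : ℝ) * ‖x‖ ≤ k * (‖x0‖ + ‖x - x0‖) :=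
      mul_le_mul_of_nonneg_left hxn (Nat.cast_nonneg k)
    rw [hq]
    have := abs_add_le (ψ e) (∑ i, A e i * x i)
    rw [hB]
    linarith
  have hB0 : 0 ≤ B := le_trans (abs_nonneg _) (hqB ⟨0, hm⟩)
  have hfin : δ₀ + δ₁ * ‖x - x0‖ = 2 * B * ((ℓ : ℝ) - k - 2) := by
    rw [hδ₀, hδ₁, hB]; ring
  rw [hfin]
  unfold rowSumNorm
  refine ciSup_le fun c => ?_
  rw [← Finset.add_sum_erase _ _ (Finset.mem_univ c)]
  have hd : |(J x - H x) c c| = 0 := by simp [hH]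
  rw [hd, zero_add]
  calc ∑ d ∈ Finset.univ.erase c, |(J x - H x) c d|
      ≤ ∑ d ∈ Finset.univ.erase c, 2 * B * ∑ e, |A e c| * |A e d| := by
        refine Finset.sum_le_sum fun d hdc => ?_
        have hne : c ≠ d := (Finset.ne_of_mem_erase hdc).symm
        rw [Matrix.sub_apply, hH, Matrix.diagonal_apply_ne _ hne, sub_zero, hJ, abs_mul,
          abs_two, mul_assoc]
        refine mul_le_mul_of_nonneg_left ?_ zero_le_two
        rw [Finset.mul_sum]
        refine (Finset.abs_sum_le_sum_abs _ _).trans (Finset.sum_le_sum fun e _ => ?_)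
        rw [abs_mul, abs_mul, abs_abs, mul_comm]
        exact mul_le_mul_of_nonneg_right (hqB e) (by positivity)
    _ = 2 * B * ∑ d ∈ Finset.univ.erase c, ∑ e, |A e c| * |A e d| := by
        rw [Finset.mul_sum]
    _ ≤ 2 * B * ((ℓ : ℝ) - k - 2) :=
        mul_le_mul_of_nonneg_left (hcol c) (by positivity)
end

section
/- Convergence conditions of Algorithm HC-loop (Theorem 4.4): Fix positive integers m, k, an integer ℓ, an m×k real matrix A with entries in {−1, 0, 1} satisfying, for every c, both Σ_{d=1}^k Σ_{e=1}^m |A_{ec}||A_{ed}| ≤ ℓ − k + 1 and Σ_{d ≠ c} Σ_{e=1}^m |A_{ec}||A_{ed}| ≤ ℓ − k − 2, and fix ψ ∈ ℝ^m with ψ_max = max_e |ψ_e|. Let q(x)_e = ψ_e + Σ_i A_{ei} x_i, F(x)_c = Σ_e A_{ec} q(x)_e |q(x)_e|, J(x)_{cd} = 2 Σ_e A_{ec} A_{ed} |q(x)_e|, and let H(x) be the diagonal matrix with entries J(x)_{cc}. Let x⁽⁰⁾ ∈ ℝ^k be such that H(x⁽⁰⁾) is invertible, and set β = ‖H(x⁽⁰⁾)⁻¹‖,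 η = ‖H(x⁽⁰⁾)⁻¹·F(x⁽⁰⁾)‖, K = 2(ℓ − k + 1), L = 2k(ℓ − k + 1), δ₀ = 2(ℓ − k − 2)(ψ_max + k‖x⁽⁰⁾‖), δ₁ = 2k(ℓ − k − 2). If βδ₀ < 1 and βηL·max(1, (K + δ₁)/L)/(1 − βδ₀)² ≤ 1/2, then the Hardy Cross iteration x⁽ᵗ⁾ = x⁽ᵗ⁻¹⁾ − H(x⁽ᵗ⁻¹⁾)⁻¹·F(x⁽ᵗ⁻¹⁾) is well defined (each H(x⁽ᵗ⁾) is invertible) and converges to a point x* with F(x*) = 0 with linear order: there exist c ∈ [0, 1) and t̄ such that ‖x⁽ᵗ⁾ − x*‖ ≤ c‖x⁽ᵗ⁻¹⁾ − x*‖ for all t ≥ t̄. -/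
open Matrix Filter

/-- The Hardy Cross sequence `x⁽ᵗ⁾ = x⁽ᵗ⁻¹⁾ - H(x⁽ᵗ⁻¹⁾)⁻¹ F(x⁽ᵗ⁻¹⁾)` starting at `x0`,
where `H(x)` is the diagonal part of the Jacobian. -/
noncomputable def hcSeq {k : ℕ} (F : (Fin k → ℝ) → Fin k → ℝ)
    (H : (Fin k → ℝ) → Matrix (Fin k) (Fin k) ℝ) (x0 : Fin k → ℝ) : ℕ → Fin k → ℝ
  | 0 => x0
  | t + 1 => hcSeq F H x0 t - (H (hcSeq F H x0 t))⁻¹.mulVec (F (hcSeq F H x0 t))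

lemma hc_norm_mul_le {k : ℕ} (v : Fin k → ℝ) (w B : ℝ) (hw : 0 < w) (hB : 0 ≤ B)
    (h : ∀ c, |v c| * w ≤ B) : ‖v‖ * w ≤ B := by
  rw [← le_div_iff₀ hw]
  refine (pi_norm_le_iff_of_nonneg (by positivity)).2 fun c => ?_
  rw [le_div_iff₀ hw]
  exact h c

lemma hc_abstract {k : ℕ} (F h : (Fin k → ℝ) → Fin k → ℝ) (x : ℕ → Fin k → ℝ)
    (β η K L M δ₀ δ₁ : ℝ) (hβ : 0 < β) (hK : 0 ≤ K) (hL : 0 ≤ L) (hM : 0 < M)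
    (hδ₀ : 0 ≤ δ₀) (hδ₁ : 0 ≤ δ₁) (hKM : K + δ₁ ≤ M) (hLM : L ≤ M)
    (ha : 0 < 1 - β * δ₀) (hη : 2 * (β * M) * η ≤ (1 - β * δ₀) ^ 2)
    (hh0 : ∀ c, 1 ≤ β * h (x 0) c)
    (hhK : ∀ y c, |h y c - h (x 0) c| ≤ K * ‖y - x 0‖)
    (hrem : ∀ y z c, |F z c - F y c - h y c * (z c - y c)| ≤
      (L / 2 * ‖z - y‖ + δ₀ + δ₁ * ‖y - x 0‖) * ‖z - y‖)
    (hFc : Continuous F) (hhc : Continuous h)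
    (hrec : ∀ n, (∀ c, 0 < h (x n) c) → ∀ c, h (x n) c * (x (n + 1) c - x n c) = - F (x n) c)
    (hd0 : ‖x 1 - x 0‖ ≤ η)
    (hcase : L < M ∨ (δ₀ = 0 ∧ δ₁ = 0)) :
    (∀ n c, 0 < h (x n) c) ∧ ∃ xs : Fin k → ℝ, F xs = 0 ∧ Tendsto x atTop (nhds xs) ∧
      ∃ c : ℝ, 0 ≤ c ∧ c < 1 ∧ ∃ T : ℕ, ∀ t ≥ T, ‖x (t + 1) - xs‖ ≤ c * ‖x t - xs‖ := by
  set a := 1 - β * δ₀ with ha_def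
  have ha1 : a ≤ 1 := by have := mul_nonneg hβ.le hδ₀; linarith
  have hβM : 0 < β * M := mul_pos hβ hM
  obtain ⟨d, hd⟩ : ∃ d : ℕ → ℝ, ∀ n, d n = ‖x (n + 1) - x n‖ := ⟨_, fun _ => rfl⟩
  have hdn : ∀ n, 0 ≤ d n := fun n => by rw [hd]; positivity
  obtain ⟨τ, hτ⟩ : ∃ τ : ℕ → ℝ, ∀ n, τ n = ∑ i ∈ Finset.range n, d i := ⟨_, fun _ => rfl⟩
  have hτ0 : τ 0 = 0 := by simp [hτ]
  have hτs : ∀ n, τ (n + 1) = τ n + d n := fun n => by rw [hτ, hτ, Finset.sum_range_succ]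
  have hτn : ∀ n, 0 ≤ τ n := fun n => by rw [hτ]; exact Finset.sum_nonneg fun i _ => hdn i
  obtain ⟨κ, hκ⟩ : ∃ κ : ℕ → ℝ, ∀ n, κ n = β * (M - L) / 2 * ∑ i ∈ Finset.range n, d i ^ 2 :=
    ⟨_, fun _ => rfl⟩
  have hκ0 : κ 0 = 0 := by simp [hκ]
  have hκs : ∀ n, κ (n + 1) = κ n + β * (M - L) / 2 * d n ^ 2 := fun n => by
    rw [hκ, hκ, Finset.sum_range_succ]; ring
  have hML : 0 ≤ β * (M - L) / 2 := by
    have := mul_nonneg hβ.le (sub_nonneg.2 hLM); linarith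
  have hκn : ∀ n, 0 ≤ κ n := fun n => by
    rw [hκ]; exact mul_nonneg hML (Finset.sum_nonneg fun i _ => sq_nonneg _)
  -- distance between iterates
  have hdist : ∀ n j, ‖x (n + j) - x n‖ ≤ τ (n + j) - τ n := by
    intro n j
    induction j with
    | zero => simp
    | succ j ih =>
      have h1 : x (n + (j + 1)) - x n = (x (n + j + 1) - x (n + j)) + (x (n + j) - x n) := by
        rw [← add_assoc]; abel
      have h2 := hτs (n + j)
      have h3 := hd (n + j)
      rw [h1]
      refine (norm_add_le _ _).trans ?_
      rw [← add_assoc]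
      linarith
  have hr : ∀ n, ‖x n - x 0‖ ≤ τ n := fun n => by
    have := hdist 0 n
    simpa [hτ0] using this
  -- lower bound on h
  have hlow : ∀ n c, 1 - β * K * τ n ≤ β * h (x n) c := by
    intro n c
    have h1 := (abs_le.1 (hhK (x n) c)).1
    have h2 := mul_le_mul_of_nonneg_left (hr n) hK
    have h3 := mul_le_mul_of_nonneg_left (show h (x 0) c - K * τ n ≤ h (x n) c by linarith) hβ.le
    have := hh0 c
    nlinarith
  have hwg : ∀ n, (a - β * M * τ n) + β * (δ₀ + δ₁ * τ n) ≤ 1 - β * K * τ n := by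
    intro n
    have : 0 ≤ β * τ n * (M - (K + δ₁)) :=
      mul_nonneg (mul_nonneg hβ.le (hτn n)) (by linarith)
    rw [ha_def]; nlinarith
  have hδn : ∀ n, 0 ≤ β * (δ₀ + δ₁ * τ n) := fun n => by have := hτn n; positivity
  have hposn : ∀ n, 0 < a - β * M * τ n → ∀ c, 0 < h (x n) c := by
    intro n hg c
    have := hlow n c
    have := hwg n
    have := hδn n
    have : 0 < β * h (x n) c := by linarith
    exact (pos_iff_pos_of_mul_pos this).1 hβ
  -- step bound
  have hstep : ∀ n, 0 < a - β * M * τ n → 0 < a - β * M * τ (n + 1) →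
      (1 - β * K * τ (n + 1)) * d (n + 1) ≤ β * (L / 2 * d n + δ₀ + δ₁ * τ n) * d n := by
    intro n hg hg'
    have hB : 0 ≤ β * (L / 2 * d n + δ₀ + δ₁ * τ n) * d n := by
      have := hdn n; have := hτn n; positivity
    rw [mul_comm (1 - _), hd (n + 1)]
    refine hc_norm_mul_le _ _ _ ?_ hB fun c => ?_
    · have := hwg (n + 1); have := hδn (n + 1); linarith
    have e1 := hrec n (hposn n hg) c
    have e2 := hrec (n + 1) (hposn (n + 1) hg') c
    have e3 := hrem (x n) (x (n + 1)) c
    rw [e1, sub_neg_eq_add, sub_add_cancel, ← hd] at e3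
    have hp := hposn (n + 1) hg' c
    have e4 : |(x (n + 1 + 1) - x (n + 1)) c| * h (x (n + 1)) c = |F (x (n + 1)) c| := by
      rw [← abs_neg (F _ _), ← e2, abs_mul, abs_of_pos hp, mul_comm]; rfl
    have e5 : (L / 2 * d n + δ₀ + δ₁ * ‖x n - x 0‖) * d n ≤
        (L / 2 * d n + δ₀ + δ₁ * τ n) * d n := by
      have := hr n
      have := hdn n
      gcongr
    calc |(x (n + 1 + 1) - x (n + 1)) c| * (1 - β * K * τ (n + 1))
        ≤ |(x (n + 1 + 1) - x (n + 1)) c| * (β * h (x (n + 1)) c) :=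
          mul_le_mul_of_nonneg_left (hlow _ c) (abs_nonneg _)
      _ = β * |F (x (n + 1)) c| := by rw [← e4]; ring
      _ ≤ β * ((L / 2 * d n + δ₀ + δ₁ * τ n) * d n) :=
          mul_le_mul_of_nonneg_left (e3.trans e5) hβ.le
      _ = _ := by ring
  -- main induction
  have hmain : ∀ n, 0 < a - β * M * τ n ∧
      (1 - β * K * τ n) * d n + κ n ≤ β * M / 2 * τ n ^ 2 - a * τ n + η := by
    intro n
    induction n with
    | zero =>
      rw [hτ0, hκ0, hd]
      simp only [zero_add]
      constructor
      · simpa using ha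
      · simpa using hd0
    | succ n ih =>
      obtain ⟨hg, hp⟩ := ih
      have h1 := hwg n
      have h2 := hδn n
      have h3 := hκn n
      have h4 := hdn n
      -- d n ≤ g / (2 βM)
      have hgd : (a - β * M * τ n) * d n ≤ β * M / 2 * τ n ^ 2 - a * τ n + η := by
        have : (a - β * M * τ n) * d n ≤ (1 - β * K * τ n) * d n :=
          mul_le_mul_of_nonneg_right (by linarith) h4
        linarith
      have hgd2 : (a - β * M * τ n) * (2 * (β * M) * d n) ≤
          (a - β * M * τ n) * (a - β * M * τ n) := by
        have := mul_le_mul_of_nonneg_left hgd (show 0 ≤ 2 * (β * M) by positivity)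
        nlinarith
      have hgd3 := le_of_mul_le_mul_left hgd2 hg
      have hg' : 0 < a - β * M * τ (n + 1) := by
        rw [hτs]; nlinarith
      refine ⟨hg', ?_⟩
      have h5 := hstep n hg hg'
      rw [hκs]
      have h6 : 0 ≤ β * τ n * (M - (K + δ₁)) * d n :=
        mul_nonneg (mul_nonneg (mul_nonneg hβ.le (hτn n)) (by linarith)) h4
      have h7 : β * M / 2 * τ (n + 1) ^ 2 - a * τ (n + 1) + η =
        (β * M / 2 * τ n ^ 2 - a * τ n + η) + (β * M * τ n - a) * d n + β * M / 2 * d n ^ 2 := by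
        rw [hτs]; ring
      rw [h7]
      have h8 : (1 - β * K * τ n) * d n + (β * M * τ n - a) * d n + β * M / 2 * d n ^ 2
        = β * (L / 2 * d n + δ₀ + δ₁ * τ n) * d n + β * (M - L) / 2 * d n ^ 2
          + β * τ n * (M - (K + δ₁)) * d n := by
        rw [ha_def]; ring
      linarith
  have hg : ∀ n, 0 < a - β * M * τ n := fun n => (hmain n).1
  have hpos : ∀ n c, 0 < h (x n) c := fun n => hposn n (hg n)
  refine ⟨hpos, ?_⟩
  have hsum : Summable d := by
    refine summable_of_sum_range_le (c := a / (β * M)) hdn fun n => ?_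
    rw [← hτ, le_div_iff₀ hβM]
    have := hg n
    linarith
  have hcau : CauchySeq x := by
    refine cauchySeq_of_summable_dist ?_
    refine hsum.congr fun n => ?_
    rw [hd, dist_comm, dist_eq_norm]
  obtain ⟨xs, hxs⟩ := cauchySeq_tendsto_of_complete hcau
  have hFxs : F xs = 0 := by
    funext c
    have t1 : Tendsto (fun n => F (x n) c) atTop (nhds (F xs c)) :=
      (((continuous_apply c).comp hFc).tendsto xs).comp hxs
    have t2 : Tendsto (fun n => h (x n) c) atTop (nhds (h xs c)) :=
      (((continuous_apply c).comp hhc).tendsto xs).comp hxs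
    have t3 : Tendsto (fun n => x n c) atTop (nhds (xs c)) :=
      ((continuous_apply c).tendsto xs).comp hxs
    have t4 : Tendsto (fun n => x (n + 1) c) atTop (nhds (xs c)) :=
      (tendsto_add_atTop_iff_nat (f := fun n => x n c) 1).2 t3
    have t5 := (t2.mul (t4.sub t3)).neg
    have t6 : (fun n => -(h (x n) c * (x (n + 1) c - x n c))) = fun n => F (x n) c := by
      funext n
      rw [hrec n (hpos n) c, neg_neg]
    rw [t6] at t5
    have := tendsto_nhds_unique t1 t5
    simpa using this
  refine ⟨xs, hFxs, hxs, ?_⟩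
  -- error bound
  have herr : ∀ n, ‖x (n + 1) - xs‖ * (1 - β * K * τ n) ≤
      β * (L / 2 * ‖x n - xs‖ + δ₀ + δ₁ * τ n) * ‖x n - xs‖ := by
    intro n
    have h0 := hτn n
    refine hc_norm_mul_le _ _ _ ?_ (by positivity) fun c => ?_
    · have := hwg n; have := hδn n; have := hg n; linarith
    have e1 := hrec n (hpos n) c
    have e3 := hrem (x n) xs c
    rw [norm_sub_rev xs] at e3
    have e6 : F xs c - F (x n) c - h (x n) c * (xs c - x n c) =
        h (x n) c * (x (n + 1) - xs) c := by
      rw [hFxs, Pi.sub_apply, Pi.zero_apply]; linarith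
    rw [e6, abs_mul, abs_of_pos (hpos n c)] at e3
    have e5 : (L / 2 * ‖x n - xs‖ + δ₀ + δ₁ * ‖x n - x 0‖) * ‖x n - xs‖ ≤
        (L / 2 * ‖x n - xs‖ + δ₀ + δ₁ * τ n) * ‖x n - xs‖ := by
      have := hr n
      gcongr
    calc |(x (n + 1) - xs) c| * (1 - β * K * τ n)
        ≤ |(x (n + 1) - xs) c| * (β * h (x n) c) :=
          mul_le_mul_of_nonneg_left (hlow _ c) (abs_nonneg _)
      _ = β * (h (x n) c * |(x (n + 1) - xs) c|) := by ring
      _ ≤ β * ((L / 2 * ‖x n - xs‖ + δ₀ + δ₁ * τ n) * ‖x n - xs‖) :=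
          mul_le_mul_of_nonneg_left (e3.trans e5) hβ.le
      _ = _ := by ring
  rcases hcase with hlt | ⟨hz0, hz1⟩
  · -- uniform gap
    obtain ⟨γ, hγ0, hγ1, hγ⟩ : ∃ γ : ℝ, 0 < γ ∧ γ ≤ 1 ∧ ∀ n, γ ≤ a - β * M * τ n := by
      rcases (hdn 0).eq_or_lt with hz | hz
      · have hdz : ∀ n, d n = 0 := by
          intro n
          induction n with
          | zero => exact hz.symm
          | succ n ih =>
            have h1 := hstep n (hg n) (hg (n + 1))
            rw [ih, mul_zero] at h1
            have h2 : 0 < 1 - β * K * τ (n + 1) := by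
              have := hwg (n + 1); have := hδn (n + 1); have := hg (n + 1); linarith
            have h3 := hdn (n + 1)
            by_contra hne
            have h4 : 0 < d (n + 1) := lt_of_le_of_ne h3 (Ne.symm hne)
            have := mul_pos h2 h4
            linarith
        refine ⟨a, ha, ha1, fun n => ?_⟩
        have : τ n = 0 := by rw [hτ]; exact Finset.sum_eq_zero fun i _ => hdz i
        rw [this]; simp
      · have hκp : 0 < κ 1 := by
          rw [hκ]
          have : 0 < M - L := by linarith
          simp only [Finset.range_one, Finset.sum_singleton]
          positivity
        have hκm : ∀ n, κ 1 ≤ κ (n + 1) := by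
          intro n
          induction n with
          | zero => exact le_rfl
          | succ n ih =>
            have := hκs (n + 1)
            have := mul_nonneg hML (sq_nonneg (d (n + 1)))
            linarith
        refine ⟨min a (Real.sqrt (2 * (β * M) * κ 1)), lt_min ha (Real.sqrt_pos.2 (by positivity)),
          (min_le_left _ _).trans ha1, fun n => ?_⟩
        rcases n with _ | n
        · refine (min_le_left _ _).trans ?_
          rw [hτ0]; simp
        · refine (min_le_right _ _).trans ?_
          refine Real.sqrt_le_iff.2 ⟨(hg _).le, ?_⟩
          have h1 := (hmain (n + 1)).2
          have h2 : 0 ≤ (1 - β * K * τ (n + 1)) * d (n + 1) := by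
            refine mul_nonneg ?_ (hdn _)
            have := hwg (n + 1); have := hδn (n + 1); have := hg (n + 1); linarith
          have h3 := hκm n
          have h4 : κ 1 ≤ β * M / 2 * τ (n + 1) ^ 2 - a * τ (n + 1) + η := by linarith
          have h5 := mul_le_mul_of_nonneg_left h4 (show 0 ≤ 2 * (β * M) by positivity)
          nlinarith
    refine ⟨1 - γ / 2, by linarith, by linarith, ?_⟩
    have t1 : Tendsto (fun n => β * (L / 2 * ‖x n - xs‖)) atTop (nhds 0) := by
      have := (((tendsto_iff_norm_sub_tendsto_zero.1 hxs).const_mul (L / 2)).const_mul β)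
      simpa using this
    obtain ⟨T, hT⟩ := eventually_atTop.1 (t1.eventually (gt_mem_nhds (show 0 < γ / 2 by linarith)))
    refine ⟨T, fun n hn => ?_⟩
    have h1 := hT n hn
    have h2 := herr n
    have h3 := hγ n
    have h4 := hwg n
    have h5 := hδn n
    have hw : 0 < 1 - β * K * τ n := by have := hg n; linarith
    have hw1 : 1 - β * K * τ n ≤ 1 := by
      have : 0 ≤ β * K * τ n := mul_nonneg (mul_nonneg hβ.le hK) (hτn n)
      linarith
    refine le_of_mul_le_mul_right (h2.trans ?_) hw
    have h6 : β * (L / 2 * ‖x n - xs‖ + δ₀ + δ₁ * τ n) ≤ (1 - γ / 2) * (1 - β * K * τ n) := by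
      nlinarith
    have := mul_le_mul_of_nonneg_right h6 (norm_nonneg (x n - xs))
    linarith
  · subst hz0 hz1
    refine ⟨1 / 2, by norm_num, by norm_num, 0, fun n _ => ?_⟩
    have h2 := herr n
    have h4 := hwg n
    have hw : 0 < 1 - β * K * τ n := by have := hg n; have := hδn n; linarith
    have he : β * M * ‖x n - xs‖ ≤ a - β * M * τ n := by
      have t1 : Tendsto (fun j => β * M * ‖x n - x (j + n)‖) atTop
          (nhds (β * M * ‖x n - xs‖)) :=
        ((tendsto_const_nhds.sub ((tendsto_add_atTop_iff_nat n).2 hxs)).norm).const_mul _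
      refine le_of_tendsto' t1 fun j => ?_
      have h1 := hdist n j
      rw [norm_sub_rev, add_comm j n]
      have h2 := hg (n + j)
      have h3 := mul_le_mul_of_nonneg_left h1 hβM.le
      linarith
    refine le_of_mul_le_mul_right (h2.trans ?_) hw
    have h5 : β * L * ‖x n - xs‖ ≤ β * M * ‖x n - xs‖ := by gcongr
    have h6 : β * (L / 2 * ‖x n - xs‖ + 0 + 0 * τ n) ≤ 1 / 2 * (1 - β * K * τ n) := by
      linarith
    have := mul_le_mul_of_nonneg_right h6 (norm_nonneg (x n - xs))
    linarith

lemma hc_quad (u v : ℝ) : |v * |v| - u * |u| - 2 * |u| * (v - u)| ≤ (v - u) ^ 2 := by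
  rw [abs_le]
  rcases le_total 0 u with hu | hu <;> rcases le_total 0 v with hv | hv <;>
    simp only [abs_of_nonneg, abs_of_nonpos, hu, hv] <;> constructor <;>
    nlinarith [mul_nonneg (sub_nonneg.2 hu) (sub_nonneg.2 hv), sq_nonneg u, sq_nonneg v,
      sq_nonneg (u - v)]

/-- Theorem 4.4 (convergence conditions of Algorithm HC-loop): for the loop error function
`F` with Jacobian `J` and diagonal part `H`, under the combinatorial hypotheses on the
edge–cycle matrix `A`, with `β = ‖H(x⁽⁰⁾)⁻¹‖`, `η = ‖H(x⁽⁰⁾)⁻¹ F(x⁽⁰⁾)‖`,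
`K = 2(ℓ-k+1)`, `L = 2k(ℓ-k+1)`, `δ₀ = 2(ℓ-k-2)(ψ_max + k‖x⁽⁰⁾‖)`, `δ₁ = 2k(ℓ-k-2)`,
if `βδ₀ < 1` and `βηL·max(1,(K+δ₁)/L)/(1-βδ₀)² ≤ 1/2`, then the Hardy Cross iteration is
well defined and converges to a zero of `F` with linear order. -/
theorem hcLoop_convergence {m k : ℕ} (hm : 0 < m) (hk : 0 < k) (ℓ : ℤ)
    (A : Matrix (Fin m) (Fin k) ℝ)
    (hA : ∀ e c, A e c = -1 ∨ A e c = 0 ∨ A e c = 1)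
    (hcol : ∀ c, ∑ d, ∑ e, |A e c| * |A e d| ≤ (ℓ : ℝ) - k + 1)
    (hcol' : ∀ c, ∑ d ∈ Finset.univ.erase c, ∑ e, |A e c| * |A e d| ≤ (ℓ : ℝ) - k - 2)
    (ψ : Fin m → ℝ) (ψmax : ℝ) (hψmax : ψmax = ⨆ e, |ψ e|)
    (q : (Fin k → ℝ) → Fin m → ℝ)
    (hq : ∀ x e, q x e = ψ e + ∑ i, A e i * x i)
    (F : (Fin k → ℝ) → Fin k → ℝ)
    (hF : ∀ x c, F x c = ∑ e, A e c * (q x e * |q x e|))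
    (J : (Fin k → ℝ) → Matrix (Fin k) (Fin k) ℝ)
    (hJ : ∀ x c d, J x c d = 2 * ∑ e, A e c * A e d * |q x e|)
    (H : (Fin k → ℝ) → Matrix (Fin k) (Fin k) ℝ)
    (hH : ∀ x, H x = Matrix.diagonal fun c => J x c c)
    (x0 : Fin k → ℝ) (hinv : IsUnit (H x0))
    (β η K L δ₀ δ₁ : ℝ)
    (hβ : β = rowSumNorm (H x0)⁻¹)
    (hη : η = ‖(H x0)⁻¹.mulVec (F x0)‖)
    (hK : K = 2 * ((ℓ : ℝ) - k + 1))
    (hL : L = 2 * k * ((ℓ : ℝ) - k + 1))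
    (hδ₀ : δ₀ = 2 * ((ℓ : ℝ) - k - 2) * (ψmax + k * ‖x0‖))
    (hδ₁ : δ₁ = 2 * k * ((ℓ : ℝ) - k - 2))
    (hβδ : β * δ₀ < 1)
    (hh : β * η * L * max 1 ((K + δ₁) / L) / (1 - β * δ₀) ^ 2 ≤ 1 / 2) :
    (∀ t, IsUnit (H (hcSeq F H x0 t))) ∧
    ∃ xstar : Fin k → ℝ, F xstar = 0 ∧
      Tendsto (hcSeq F H x0) atTop (nhds xstar) ∧
      ∃ c : ℝ, 0 ≤ c ∧ c < 1 ∧ ∃ T : ℕ, ∀ t ≥ T,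
        ‖hcSeq F H x0 (t + 1) - xstar‖ ≤ c * ‖hcSeq F H x0 t - xstar‖ := by
  have : NeZero k := ⟨hk.ne'⟩
  have hk1 : (1 : ℝ) ≤ k := by exact_mod_cast hk
  obtain ⟨s, hs⟩ : ∃ s : ℝ, s = (ℓ : ℝ) - k + 1 := ⟨_, rfl⟩
  have hs3 : (ℓ : ℝ) - k - 2 = s - 3 := by rw [hs]; ring
  simp only [hs3, ← hs] at *
  -- combinatorial quantities
  obtain ⟨D, hD⟩ : ∃ D : Fin m → ℝ, ∀ e, D e = ∑ d, |A e d| := ⟨_, fun _ => rfl⟩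
  obtain ⟨O, hO⟩ : ∃ O : Fin k → ℝ, ∀ c, O c = ∑ d ∈ Finset.univ.erase c, ∑ e, |A e c| * |A e d| :=
    ⟨_, fun _ => rfl⟩
  obtain ⟨N, hN⟩ : ∃ N : Fin k → ℝ, ∀ c, N c = ∑ e, |A e c| := ⟨_, fun _ => rfl⟩
  obtain ⟨S, hS⟩ : ∃ S : Fin k → ℝ, ∀ c, S c = ∑ e, |A e c| * D e ^ 2 := ⟨_, fun _ => rfl⟩
  have hA1 : ∀ e c, |A e c| ≤ 1 := fun e c => by
    rcases hA e c with h | h | h <;> simp [h]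
  have hAA : ∀ e c, A e c * A e c = |A e c| := fun e c => by
    rcases hA e c with h | h | h <;> simp [h]
  have hAA' : ∀ e c, |A e c| * |A e c| = |A e c| := fun e c => by
    rcases hA e c with h | h | h <;> simp [h]
  have hDn : ∀ e, 0 ≤ D e := fun e => by
    rw [hD]; exact Finset.sum_nonneg fun _ _ => abs_nonneg _
  have hDk : ∀ e, D e ≤ k := fun e => by
    rw [hD]
    refine (Finset.sum_le_sum fun d _ => hA1 e d).trans ?_
    simp
  have hDA : ∀ e c, |A e c| ≤ |A e c| * D e := fun e c => by
    have h1 : |A e c| ≤ D e := by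
      rw [hD]
      exact Finset.single_le_sum (f := fun d => |A e d|) (fun _ _ => abs_nonneg _)
        (Finset.mem_univ c)
    calc |A e c| = |A e c| * |A e c| := (hAA' e c).symm
      _ ≤ _ := mul_le_mul_of_nonneg_left h1 (abs_nonneg _)
  have hAD : ∀ c, ∑ d, ∑ e, |A e c| * |A e d| = ∑ e, |A e c| * D e := fun c => by
    rw [Finset.sum_comm]
    refine Finset.sum_congr rfl fun e _ => ?_
    rw [hD, Finset.mul_sum]
  have hADs : ∀ c, ∑ e, |A e c| * D e ≤ s := fun c => (hAD c) ▸ hcol c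
  have hON : ∀ c, ∑ e, |A e c| * D e = N c + O c := fun c => by
    rw [← hAD, ← Finset.add_sum_erase _ _ (Finset.mem_univ c), ← hO, hN]
    congr 1
    exact Finset.sum_congr rfl fun e _ => hAA' e c
  have hOs : ∀ c, O c ≤ s - 3 := fun c => by rw [hO]; exact hcol' c
  have hO0 : ∀ c, 0 ≤ O c := fun c => by
    rw [hO]
    exact Finset.sum_nonneg fun _ _ => Finset.sum_nonneg fun _ _ => by positivity
  have hs30 : 0 ≤ s - 3 := (hO0 0).trans (hOs 0)
  have hS0 : ∀ c, 0 ≤ S c := fun c => by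
    rw [hS]
    exact Finset.sum_nonneg fun _ _ => by positivity
  have hSgap : ∀ c, S c ≤ k * s - (k * N c - (N c + O c)) := by
    intro c
    have h1 : S c ≤ k * (∑ e, |A e c| * D e) - (k * N c - ∑ e, |A e c| * D e) := by
      rw [hS, hN, Finset.mul_sum, Finset.mul_sum, ← Finset.sum_sub_distrib, ← Finset.sum_sub_distrib]
      refine Finset.sum_le_sum fun e _ => ?_
      have := mul_nonneg (sub_nonneg.2 (hDA e c)) (sub_nonneg.2 (hDk e))
      nlinarith
    have h2 := mul_le_mul_of_nonneg_left (hADs c) (show (0 : ℝ) ≤ k by linarith)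
    rw [← hON]
    linarith
  have hSle : ∀ c, S c ≤ k * s := by
    intro c
    have h1 : S c ≤ k * (∑ e, |A e c| * D e) := by
      rw [hS, Finset.mul_sum]
      refine Finset.sum_le_sum fun e _ => ?_
      have := mul_nonneg (mul_nonneg (abs_nonneg (A e c)) (hDn e)) (sub_nonneg.2 (hDk e))
      nlinarith
    have h2 := mul_le_mul_of_nonneg_left (hADs c) (show (0 : ℝ) ≤ k by linarith)
    linarith
  -- flow bounds
  have hψ : ∀ e, |ψ e| ≤ ψmax := fun e => by
    rw [hψmax]
    exact le_ciSup (f := fun e => |ψ e|) (Set.finite_range _).bddAbove e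
  have hψ0 : 0 ≤ ψmax := (abs_nonneg _).trans (hψ ⟨0, hm⟩)
  have hlin : ∀ e (v : Fin k → ℝ), |∑ i, A e i * v i| ≤ D e * ‖v‖ := fun e v => by
    refine (Finset.abs_sum_le_sum_abs _ _).trans ?_
    rw [hD, Finset.sum_mul]
    refine Finset.sum_le_sum fun i _ => ?_
    rw [abs_mul]
    exact mul_le_mul_of_nonneg_left (norm_le_pi_norm v i) (abs_nonneg _)
  have hqd : ∀ z y e, q z e - q y e = ∑ i, A e i * (z - y) i := fun z y e => by
    rw [hq, hq, add_sub_add_left_eq_sub, ← Finset.sum_sub_distrib]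
    refine Finset.sum_congr rfl fun i _ => ?_
    rw [Pi.sub_apply]; ring
  have hqdb : ∀ z y e, |q z e - q y e| ≤ D e * ‖z - y‖ := fun z y e => by
    rw [hqd]; exact hlin e _
  have hqb : ∀ y e, |q y e| ≤ ψmax + k * ‖y‖ := fun y e => by
    rw [hq]
    refine (abs_add_le _ _).trans (add_le_add (hψ e) ((hlin e y).trans ?_))
    exact mul_le_mul_of_nonneg_right (hDk e) (norm_nonneg _)
  have hqc : Continuous q := by
    refine continuous_pi fun e => ?_
    simp only [hq]
    fun_prop
  -- diagonal
  obtain ⟨h, hh_def⟩ : ∃ h : (Fin k → ℝ) → Fin k → ℝ, ∀ x c, h x c = J x c c :=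
    ⟨fun x c => J x c c, fun _ _ => rfl⟩
  have hh_eq : ∀ x c, h x c = 2 * ∑ e, |A e c| * |q x e| := fun x c => by
    rw [hh_def, hJ]
    simp only [hAA]
  have hHd : ∀ x, H x = Matrix.diagonal (h x) := fun x => by
    rw [hH]; congr 1; funext c; rw [hh_def]
  have hunit : ∀ x, IsUnit (H x) ↔ ∀ c, h x c ≠ 0 := fun x => by
    rw [hHd, Matrix.isUnit_diagonal, Pi.isUnit_iff]
    simp only [isUnit_iff_ne_zero]
  have hhn : ∀ x c, 0 ≤ h x c := fun x c => by
    rw [hh_eq]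
    have : 0 ≤ ∑ e, |A e c| * |q x e| := Finset.sum_nonneg fun _ _ => by positivity
    linarith
  have hinvd : ∀ x, (∀ c, h x c ≠ 0) → (H x)⁻¹ = Matrix.diagonal fun c => (h x c)⁻¹ := by
    intro x hx
    refine Matrix.inv_eq_right_inv ?_
    rw [hHd, Matrix.diagonal_mul_diagonal, ← Matrix.diagonal_one]
    congr 1
    funext c
    exact mul_inv_cancel₀ (hx c)
  have hx0 := (hunit x0).1 hinv
  have hx0p : ∀ c, 0 < h x0 c := fun c => lt_of_le_of_ne (hhn _ _) (hx0 c).symm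
  have hβc : ∀ c, (h x0 c)⁻¹ ≤ β := fun c => by
    rw [hβ, rowSumNorm, hinvd x0 hx0]
    refine le_trans ?_ (le_ciSup (f := fun c => ∑ d, |Matrix.diagonal (fun c => (h x0 c)⁻¹) c d|)
      (Set.finite_range _).bddAbove c)
    refine le_trans (le_abs_self _) ?_
    have := Finset.single_le_sum (f := fun d => |Matrix.diagonal (fun c => (h x0 c)⁻¹) c d|)
        (fun _ _ => abs_nonneg _) (Finset.mem_univ c)
    simpa using this
  have hβ0 : 0 < β := lt_of_lt_of_le (inv_pos.2 (hx0p 0)) (hβc 0)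
  have hβh : ∀ c, 1 ≤ β * h x0 c := fun c => by
    have := mul_le_mul_of_nonneg_right (hβc c) (hx0p c).le
    rwa [inv_mul_cancel₀ (hx0 c)] at this
  have hNs : ∀ c, s - 3 < N c := by
    intro c
    have h1 : h x0 c ≤ 2 * (N c * (ψmax + k * ‖x0‖)) := by
      rw [hh_eq, hN, Finset.sum_mul]
      have : ∑ e, |A e c| * |q x0 e| ≤ ∑ e, |A e c| * (ψmax + k * ‖x0‖) :=
        Finset.sum_le_sum fun e _ => mul_le_mul_of_nonneg_left (hqb x0 e) (abs_nonneg _)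
      linarith
    have h2 := mul_le_mul_of_nonneg_left h1 hβ0.le
    have h3 := hβh c
    rw [hδ₀] at hβδ
    refine lt_of_mul_lt_mul_left (a := β * 2 * (ψmax + k * ‖x0‖)) ?_ (by positivity)
    linarith
  -- remainder
  have hremG : ∀ y z c, |F z c - F y c - h y c * (z c - y c)| ≤
      (S c * ‖z - y‖ + O c * (2 * (ψmax + k * ‖y‖))) * ‖z - y‖ := by
    intro y z c
    have e1 : F z c - F y c - h y c * (z c - y c) =
        (∑ e, A e c * (q z e * |q z e| - q y e * |q y e| - 2 * |q y e| * (q z e - q y e))) +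
        ∑ d ∈ Finset.univ.erase c, ∑ e, A e c * A e d * (2 * |q y e| * (z - y) d) := by
      have e2 : ∑ e, A e c * (2 * |q y e| * (q z e - q y e)) =
          ∑ d, ∑ e, A e c * A e d * (2 * |q y e| * (z - y) d) := by
        rw [Finset.sum_comm]
        refine Finset.sum_congr rfl fun e _ => ?_
        rw [hqd, Finset.mul_sum, Finset.mul_sum]
        exact Finset.sum_congr rfl fun d _ => by ring
      rw [← Finset.add_sum_erase _ _ (Finset.mem_univ c)] at e2
      have e3 : ∑ e, A e c * A e c * (2 * |q y e| * (z - y) c) = h y c * (z c - y c) := by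
        rw [hh_eq, Finset.mul_sum, Finset.sum_mul]
        refine Finset.sum_congr rfl fun e _ => ?_
        rw [hAA, Pi.sub_apply]; ring
      rw [e3] at e2
      simp only [mul_sub (A _ c), Finset.sum_sub_distrib]
      rw [hF, hF]
      simp only [mul_sub, Finset.sum_sub_distrib] at e2 ⊢
      linarith
    rw [e1, add_mul]
    refine (abs_add_le _ _).trans (add_le_add ?_ ?_)
    · refine (Finset.abs_sum_le_sum_abs _ _).trans ?_
      rw [hS, Finset.sum_mul, Finset.sum_mul]
      refine Finset.sum_le_sum fun e _ => ?_
      rw [abs_mul, mul_assoc (|A e c| * D e ^ 2), mul_assoc (|A e c|)]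
      refine mul_le_mul_of_nonneg_left ((hc_quad _ _).trans ?_) (abs_nonneg _)
      have := pow_le_pow_left₀ (abs_nonneg _) (hqdb z y e) 2
      rw [sq_abs] at this
      linarith
    · refine (Finset.abs_sum_le_sum_abs _ _).trans ?_
      rw [hO, Finset.sum_mul, Finset.sum_mul]
      refine Finset.sum_le_sum fun d _ => ?_
      refine (Finset.abs_sum_le_sum_abs _ _).trans ?_
      rw [Finset.sum_mul, Finset.sum_mul]
      refine Finset.sum_le_sum fun e _ => ?_
      rw [abs_mul, abs_mul, mul_assoc (|A e c| * |A e d|)]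
      refine mul_le_mul_of_nonneg_left ?_ (by positivity)
      rw [abs_mul, abs_mul, abs_abs, abs_two]
      have h1 := hqb y e
      have h2 : |(z - y) d| ≤ ‖z - y‖ := norm_le_pi_norm (z - y) d
      gcongr
  have hKl : ∀ y z c, |h y c - h z c| ≤ K * ‖y - z‖ := by
    intro y z c
    rw [hh_eq, hh_eq, ← mul_sub, ← Finset.sum_sub_distrib, abs_mul, abs_two, hK, mul_assoc]
    refine mul_le_mul_of_nonneg_left ?_ (by norm_num)
    refine le_trans ?_ (mul_le_mul_of_nonneg_right (hADs c) (norm_nonneg _))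
    refine (Finset.abs_sum_le_sum_abs _ _).trans ?_
    rw [Finset.sum_mul]
    refine Finset.sum_le_sum fun e _ => ?_
    rw [← mul_sub, abs_mul, abs_abs, mul_assoc]
    exact mul_le_mul_of_nonneg_left ((abs_abs_sub_abs_le _ _).trans (hqdb y z e)) (abs_nonneg _)
  have hFc : Continuous F := by
    refine continuous_pi fun c => ?_
    simp only [hF]
    fun_prop
  have hhc : Continuous h := by
    refine continuous_pi fun c => ?_
    simp only [hh_eq]
    fun_prop
  have hrec : ∀ n, (∀ c, 0 < h (hcSeq F H x0 n) c) → ∀ c, h (hcSeq F H x0 n) c *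
      (hcSeq F H x0 (n + 1) c - hcSeq F H x0 n c) = - F (hcSeq F H x0 n) c := by
    intro n hp c
    rw [hcSeq, hinvd _ fun c => (hp c).ne', Pi.sub_apply, Matrix.mulVec_diagonal]
    have := (hp c).ne'
    field_simp
    ring
  have hd0 : ‖hcSeq F H x0 1 - hcSeq F H x0 0‖ ≤ η := by
    have h1 : hcSeq F H x0 1 = x0 - (H x0)⁻¹.mulVec (F x0) := rfl
    have h2 : hcSeq F H x0 0 = x0 := rfl
    rw [hη, h1, h2, sub_sub_cancel_left, norm_neg]
  -- constants
  have hspos : 0 < s := by linarith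
  have hkpos : (0 : ℝ) < k := by linarith
  have hLpos : 0 < L := by rw [hL]; positivity
  have hKpos : 0 < K := by rw [hK]; positivity
  have hδ₀n : 0 ≤ δ₀ := by rw [hδ₀]; positivity
  have hδ₁n : 0 ≤ δ₁ := by rw [hδ₁]; positivity
  have hη0 : 0 ≤ η := by rw [hη]; positivity
  obtain ⟨M, hMd⟩ : ∃ M, M = L * max 1 ((K + δ₁) / L) := ⟨_, rfl⟩
  have hLM : L ≤ M := by
    rw [hMd]; exact le_mul_of_one_le_right hLpos.le (le_max_left _ _)
  have hKM : K + δ₁ ≤ M := by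
    have := mul_le_mul_of_nonneg_left (le_max_right 1 ((K + δ₁) / L)) hLpos.le
    rwa [mul_div_cancel₀ _ hLpos.ne', ← hMd] at this
  have ha : 0 < 1 - β * δ₀ := by linarith
  have hM2 : 2 * (β * M) * η ≤ (1 - β * δ₀) ^ 2 := by
    rw [div_le_iff₀ (by positivity)] at hh
    rw [hMd]; linarith
  have hMpos : 0 < M := by linarith
  have hfin : (∀ n c, 0 < h (hcSeq F H x0 n) c) ∧ ∃ xs : Fin k → ℝ, F xs = 0 ∧
      Tendsto (hcSeq F H x0) atTop (nhds xs) ∧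
      ∃ c : ℝ, 0 ≤ c ∧ c < 1 ∧ ∃ T : ℕ, ∀ t ≥ T,
        ‖hcSeq F H x0 (t + 1) - xs‖ ≤ c * ‖hcSeq F H x0 t - xs‖ := by
    rcases Nat.lt_or_ge 1 k with hk2 | hk2
    · -- at least two cycles: the Lipschitz constant `L` is never attained
      have hk2' : (2 : ℝ) ≤ k := by exact_mod_cast hk2
      obtain ⟨c0, hc0⟩ := Finite.exists_max S
      have hlt : 2 * S c0 < L := by
        have h1 := hSgap c0
        have h2 := hNs c0
        have h3 := hOs c0
        have h4 := mul_nonneg (sub_nonneg.2 hk2') (show 0 ≤ N c0 by linarith)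
        rw [hL]; nlinarith
      refine hc_abstract F h (hcSeq F H x0) β η K (2 * S c0) M δ₀ δ₁ hβ0 hKpos.le
        (by have := hS0 c0; linarith) hMpos hδ₀n hδ₁n hKM (by linarith) ha hM2 hβh
        (fun y c => hKl y _ c) (fun y z c => (hremG y z c).trans ?_) hFc hhc hrec hd0
        (Or.inl (by linarith))
      refine mul_le_mul_of_nonneg_right ?_ (norm_nonneg _)
      have h1 := mul_le_mul_of_nonneg_right (hc0 c) (norm_nonneg (z - y))
      have h2 : ‖y‖ ≤ ‖x0‖ + ‖y - x0‖ := norm_le_norm_add_norm_sub' y x0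
      have h3 : O c * (2 * (ψmax + k * ‖y‖)) ≤
          (s - 3) * (2 * (ψmax + k * (‖x0‖ + ‖y - x0‖))) := by
        have := hOs c
        gcongr
      have h4 : (s - 3) * (2 * (ψmax + k * (‖x0‖ + ‖y - x0‖))) = δ₀ + δ₁ * ‖y - x0‖ := by
        rw [hδ₀, hδ₁]; ring
      have h5 : hcSeq F H x0 0 = x0 := rfl
      rw [h5]
      linarith
    · have hk1' : k = 1 := by omega
      have hOz : ∀ c, O c = 0 := fun c => by
        rw [hO]
        refine Finset.sum_eq_zero fun d hd => ?_
        exfalso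
        apply Finset.ne_of_mem_erase hd
        subst hk1'
        exact Subsingleton.elim _ _
      have hβδ0 := mul_nonneg hβ0.le hδ₀n
      refine hc_abstract F h (hcSeq F H x0) β η K L M 0 0 hβ0 hKpos.le
        hLpos.le hMpos le_rfl le_rfl (by linarith) hLM (by simp) ?_ hβh
        (fun y c => hKl y _ c) (fun y z c => (hremG y z c).trans ?_) hFc hhc hrec hd0
        (Or.inr ⟨rfl, rfl⟩)
      · nlinarith
      · refine mul_le_mul_of_nonneg_right ?_ (norm_nonneg _)
        have h1 := mul_le_mul_of_nonneg_right (hSle c) (norm_nonneg (z - y))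
        rw [hOz, hL]
        linarith
  exact ⟨fun t => (hunit _).2 fun c => (hfin.1 t c).ne', hfin.2⟩
end

section
/- Improved Lipschitz constant K ≤ 4n for H on planar graphs: Fix positive integers m, k, n and an m×k real matrix A with entries in {−1, 0, 1} such that Σ_{i=1}^k |A_{ei}| ≤ 2 for every row e and Σ_{e=1}^m A_{ec}² ≤ n for every column c. Fix ψ ∈ ℝ^m, let q(x)_e = ψ_e + Σ_i A_{ei} x_i, and let H(x) be the k×k diagonal matrix with H(x)_{cc} = 2 Σ_e A_{ec}² |q(x)_e|. Then for all x, x⁽⁰⁾ ∈ ℝ^k: ‖H(x) − H(x⁽⁰⁾)‖ ≤ 4n·‖x − x⁽⁰⁾‖, with the sup norm on ℝ^k and the maximum-absolute-row-sum norm on matrices. -/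
open Matrix

/-- Improved Lipschitz constant `K ≤ 4n` for `H` on planar graphs: if `A` has entries in
`{-1,0,1}`, every row has at most two nonzero entries and every column has at most `n`
nonzero entries, then the diagonal matrix `H(x)` with `H(x)_{cc} = 2 Σ_e A_{ec}² |q(x)_e|`
satisfies `‖H(x) - H(x⁽⁰⁾)‖ ≤ 4n‖x - x⁽⁰⁾‖` (sup norm on `ℝ^k`, max absolute row sum norm
on matrices). -/
theorem hc_diag_lipschitz_planar {m k n : ℕ} (hm : 0 < m) (hk : 0 < k) (hn : 0 < n)
    (A : Matrix (Fin m) (Fin k) ℝ)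
    (hA : ∀ e c, A e c = -1 ∨ A e c = 0 ∨ A e c = 1)
    (hrow : ∀ e, ∑ i, |A e i| ≤ 2)
    (hcolsq : ∀ c, ∑ e, (A e c) ^ 2 ≤ (n : ℝ))
    (ψ : Fin m → ℝ)
    (q : (Fin k → ℝ) → Fin m → ℝ)
    (hq : ∀ x e, q x e = ψ e + ∑ i, A e i * x i)
    (H : (Fin k → ℝ) → Matrix (Fin k) (Fin k) ℝ)
    (hH : ∀ x, H x = Matrix.diagonal fun c => 2 * ∑ e, (A e c) ^ 2 * |q x e|)
    (x x0 : Fin k → ℝ) :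
    rowSumNorm (H x - H x0) ≤ 4 * n * ‖x - x0‖ := by
  have : Nonempty (Fin k) := ⟨⟨0, hk⟩⟩
  have hqd : ∀ e, |(|q x e| - |q x0 e|)| ≤ 2 * ‖x - x0‖ := by
    intro e
    refine (abs_abs_sub_abs_le_abs_sub _ _).trans ?_
    have h1 : q x e - q x0 e = ∑ i, A e i * (x - x0) i := by
      rw [hq, hq, add_sub_add_left_eq_sub, ← Finset.sum_sub_distrib]
      refine Finset.sum_congr rfl fun i _ => ?_
      simp [mul_sub]
    rw [h1]
    calc |∑ i, A e i * (x - x0) i| ≤ ∑ i, |A e i * (x - x0) i| :=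
          Finset.abs_sum_le_sum_abs _ _
      _ ≤ ∑ i, |A e i| * ‖x - x0‖ := by
          refine Finset.sum_le_sum fun i _ => ?_
          rw [abs_mul]
          exact mul_le_mul_of_nonneg_left (norm_le_pi_norm (x - x0) i) (abs_nonneg _)
      _ = (∑ i, |A e i|) * ‖x - x0‖ := by rw [Finset.sum_mul]
      _ ≤ 2 * ‖x - x0‖ := mul_le_mul_of_nonneg_right (hrow e) (norm_nonneg _)
  unfold rowSumNorm
  refine ciSup_le fun c => ?_
  rw [Finset.sum_eq_single c]
  · rw [hH, hH, Matrix.sub_apply, Matrix.diagonal_apply_eq, Matrix.diagonal_apply_eq,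
      ← mul_sub, ← Finset.sum_sub_distrib, abs_mul, abs_two]
    have h2 : |∑ e, ((A e c) ^ 2 * |q x e| - (A e c) ^ 2 * |q x0 e|)|
        ≤ n * (2 * ‖x - x0‖) := by
      calc _ ≤ ∑ e, |((A e c) ^ 2 * |q x e| - (A e c) ^ 2 * |q x0 e|)| :=
            Finset.abs_sum_le_sum_abs _ _
        _ ≤ ∑ e, (A e c) ^ 2 * (2 * ‖x - x0‖) := by
            refine Finset.sum_le_sum fun e _ => ?_
            rw [← mul_sub, abs_mul, abs_of_nonneg (sq_nonneg (A e c))]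
            exact mul_le_mul_of_nonneg_left (hqd e) (sq_nonneg _)
        _ = (∑ e, (A e c) ^ 2) * (2 * ‖x - x0‖) := by rw [Finset.sum_mul]
        _ ≤ _ := mul_le_mul_of_nonneg_right (hcolsq c) (by positivity)
    linarith
  · intro d _ hd
    rw [hH, hH, Matrix.sub_apply, Matrix.diagonal_apply_ne _ hd.symm,
      Matrix.diagonal_apply_ne _ hd.symm]
    simp
  · simp
end

section
/- Improved deviation bounds δ₀, δ₁ for planar graphs: Fix positive integers m, k and an integer ℓ. Let A be an m×k real matrix with entries in {−1, 0, 1} such that Σ_{i=1}^k |A_{ei}| ≤ 2 for every row e and Σ_{d ≠ c} Σ_{e=1}^m |A_{ec}||A_{ed}| ≤ ℓ − k − 2 for every column c. Fix ψ ∈ ℝ^m and x⁽⁰⁾ ∈ ℝ^k, set ψ_max = max_e |ψ_e|, let q(x)_e = ψ_e + Σ_i A_{ei} x_i, let J(x)_{cd} = 2 Σ_e A_{ec} A_{ed} |q(x)_e| and let H(x) be the diagonal matrix with entries J(x)_{cc}. Then for all x ∈ ℝ^k: ‖J(x) − H(x)‖ ≤ 2(ℓ − k − 2)(ψ_max + 2‖x⁽⁰⁾‖)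 + 4(ℓ − k − 2)‖x − x⁽⁰⁾‖, with the sup norm on ℝ^k and the maximum-absolute-row-sum norm on matrices. -/
open Matrix

/-- Improved deviation bounds `δ₀`, `δ₁` for planar graphs: if `A` has entries in
`{-1,0,1}`, every row has at most two nonzero entries (face cycle basis of a planar graph)
and `Σ_{d≠c} Σ_e |A_{ec}||A_{ed}| ≤ ℓ - k - 2` for every column `c`, then the Jacobian
`J(x)` and its diagonal part `H(x)` satisfy
`‖J(x) - H(x)‖ ≤ 2(ℓ-k-2)(ψ_max + 2‖x⁽⁰⁾‖) + 4(ℓ-k-2)‖x - x⁽⁰⁾‖`. -/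
theorem hc_deviation_bound_planar {m k : ℕ} (hm : 0 < m) (hk : 0 < k) (ℓ : ℤ)
    (A : Matrix (Fin m) (Fin k) ℝ)
    (hA : ∀ e c, A e c = -1 ∨ A e c = 0 ∨ A e c = 1)
    (hrow : ∀ e, ∑ i, |A e i| ≤ 2)
    (hcol : ∀ c, ∑ d ∈ Finset.univ.erase c, ∑ e, |A e c| * |A e d| ≤ (ℓ : ℝ) - k - 2)
    (ψ : Fin m → ℝ) (x0 : Fin k → ℝ)
    (ψmax : ℝ) (hψmax : ψmax = ⨆ e, |ψ e|)
    (q : (Fin k → ℝ) → Fin m → ℝ)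
    (hq : ∀ x e, q x e = ψ e + ∑ i, A e i * x i)
    (J : (Fin k → ℝ) → Matrix (Fin k) (Fin k) ℝ)
    (hJ : ∀ x c d, J x c d = 2 * ∑ e, A e c * A e d * |q x e|)
    (H : (Fin k → ℝ) → Matrix (Fin k) (Fin k) ℝ)
    (hH : ∀ x, H x = Matrix.diagonal fun c => J x c c)
    (x : Fin k → ℝ) :
    rowSumNorm (J x - H x) ≤
      2 * ((ℓ : ℝ) - k - 2) * (ψmax + 2 * ‖x0‖) + 4 * ((ℓ : ℝ) - k - 2) * ‖x - x0‖ := by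
  have hψ : ∀ e, |ψ e| ≤ ψmax := by
    intro e
    rw [hψmax]
    exact le_ciSup (f := fun e => |ψ e|) (Set.finite_range _).bddAbove e
  have hx : ‖x‖ ≤ ‖x0‖ + ‖x - x0‖ := by
    have h := norm_add_le x0 (x - x0)
    rwa [add_sub_cancel] at h
  obtain ⟨B, hB⟩ : ∃ B, B = ψmax + 2 * ‖x0‖ + 2 * ‖x - x0‖ := ⟨_, rfl⟩
  have hqB : ∀ e, |q x e| ≤ B := by
    intro e
    have h1 : |∑ i, A e i * x i| ≤ 2 * ‖x‖ := by
      calc |∑ i, A e i * x i| ≤ ∑ i, |A e i * x i| := Finset.abs_sum_le_sum_abs _ _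
        _ ≤ ∑ i, |A e i| * ‖x‖ := by
          refine Finset.sum_le_sum fun i _ => ?_
          rw [abs_mul]
          exact mul_le_mul_of_nonneg_left (norm_le_pi_norm x i) (abs_nonneg _)
        _ = (∑ i, |A e i|) * ‖x‖ := by rw [Finset.sum_mul]
        _ ≤ 2 * ‖x‖ := mul_le_mul_of_nonneg_right (hrow e) (norm_nonneg _)
    rw [hq]
    have h2 := abs_add_le (ψ e) (∑ i, A e i * x i)
    have h3 := hψ e
    linarith
  have hB0 : 0 ≤ B := (abs_nonneg _).trans (hqB ⟨0, hm⟩)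
  have hR : 2 * ((ℓ : ℝ) - k - 2) * (ψmax + 2 * ‖x0‖) + 4 * ((ℓ : ℝ) - k - 2) * ‖x - x0‖
      = ((ℓ : ℝ) - k - 2) * (2 * B) := by rw [hB]; ring
  rw [hR]
  haveI : Nonempty (Fin k) := ⟨⟨0, hk⟩⟩
  refine ciSup_le fun c => ?_
  rw [← Finset.add_sum_erase _ _ (Finset.mem_univ c)]
  have hcc : |(J x - H x) c c| = 0 := by simp [hH]
  rw [hcc, zero_add]
  refine le_trans ?_ (mul_le_mul_of_nonneg_right (hcol c) (by positivity : 0 ≤ 2 * B))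
  rw [Finset.sum_mul]
  refine Finset.sum_le_sum fun d hd => ?_
  have hdc : c ≠ d := (Finset.ne_of_mem_erase hd).symm
  have hcd : (J x - H x) c d = 2 * ∑ e, A e c * A e d * |q x e| := by
    rw [Matrix.sub_apply, hH, Matrix.diagonal_apply_ne _ hdc, sub_zero, hJ]
  rw [hcd, abs_mul, abs_two]
  have h4 : abs (∑ e, A e c * A e d * |q x e|) ≤ (∑ e, |A e c| * |A e d|) * B := by
    rw [Finset.sum_mul]
    refine (Finset.abs_sum_le_sum_abs _ _).trans (Finset.sum_le_sum fun e _ => ?_)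
    rw [abs_mul, abs_mul, abs_abs]
    exact mul_le_mul_of_nonneg_left (hqB e) (by positivity)
  linarith
end

section
/- The Hardy Cross algorithm converges no faster than linearly (lower-bound example): Define f₁, f₂ : ℝ² → ℝ by f₁(x₁, x₂) = x₁|x₁| − (3 − x₁ − x₂)|3 − x₁ − x₂| and f₂(x₁, x₂) = x₂|x₂| − (3 − x₁ − x₂)|3 − x₁ − x₂|, whose unique common zero is x* = (1, 1). The Hardy Cross update of a point x = (x₁, x₂) is x′ = (x₁ − f₁(x)/(2(|x₁| + |3 − x₁ − x₂|)), x₂ − f₂(x)/(2(|x₂| + |3 − x₁ − x₂|))). Then for every ε with 0 < ε < 1/2: starting from x⁽⁰⁾ = (1 + ε, 1 + ε) the update gives x⁽¹⁾ = (1 − ε/2, 1 − ε/2), and starting from x⁽⁰⁾ = (1 − ε, 1 − ε) it gives x⁽¹⁾ = (1 + ε/2, 1 + ε/2); in both cases ‖x⁽¹⁾ − x*‖∞ = (1/2)·‖x⁽⁰⁾ − x*‖∞, so the error is reduced by exactly the factor 1/2 and the convergence rate is exactly linear. -/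
/-- First loop error function of the two-loop network with reference flow `ψ = (0,0,3)`. -/
noncomputable def f1 (x : ℝ × ℝ) : ℝ :=
  x.1 * |x.1| - (3 - x.1 - x.2) * |3 - x.1 - x.2|

/-- Second loop error function of the two-loop network with reference flow `ψ = (0,0,3)`. -/
noncomputable def f2 (x : ℝ × ℝ) : ℝ :=
  x.2 * |x.2| - (3 - x.1 - x.2) * |3 - x.1 - x.2|

/-- The Hardy Cross update: each coordinate is corrected by `f_c(x)` divided by the
diagonal Jacobian entry `∂f_c/∂x_c = 2(|x_c| + |3 - x₁ - x₂|)`. -/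
noncomputable def hcUpdate (x : ℝ × ℝ) : ℝ × ℝ :=
  (x.1 - f1 x / (2 * (|x.1| + |3 - x.1 - x.2|)),
   x.2 - f2 x / (2 * (|x.2| + |3 - x.1 - x.2|)))

/-- The Hardy Cross algorithm converges no faster than linearly: `(1,1)` is the unique
common zero of `f₁, f₂`, and for `0 < ε < 1/2` one Hardy Cross step sends
`(1+ε, 1+ε)` to `(1-ε/2, 1-ε/2)` and `(1-ε, 1-ε)` to `(1+ε/2, 1+ε/2)`; in both cases the
sup-norm distance to the solution is reduced by exactly the factor `1/2`. -/
theorem hardyCross_linear_rate_lower_bound :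
    (∀ x : ℝ × ℝ, (f1 x = 0 ∧ f2 x = 0) ↔ x = (1, 1)) ∧
    ∀ ε : ℝ, 0 < ε → ε < 1 / 2 →
      hcUpdate (1 + ε, 1 + ε) = (1 - ε / 2, 1 - ε / 2) ∧
      hcUpdate (1 - ε, 1 - ε) = (1 + ε / 2, 1 + ε / 2) ∧
      ‖hcUpdate (1 + ε, 1 + ε) - ((1 : ℝ), (1 : ℝ))‖ =
        (1 / 2) * ‖(((1 + ε, 1 + ε) : ℝ × ℝ)) - ((1 : ℝ), (1 : ℝ))‖ ∧
      ‖hcUpdate (1 - ε, 1 - ε) - ((1 : ℝ), (1 : ℝ))‖ =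
        (1 / 2) * ‖(((1 - ε, 1 - ε) : ℝ × ℝ)) - ((1 : ℝ), (1 : ℝ))‖ := by
  have hA : ∀ ε : ℝ, 0 < ε → ε < 1 / 2 →
      hcUpdate (1 + ε, 1 + ε) = (1 - ε / 2, 1 - ε / 2) := by
    intro ε h0 h1
    have e : (3 : ℝ) - (1 + ε) - (1 + ε) = 1 - 2 * ε := by ring
    have a1 : |1 + ε| = 1 + ε := abs_of_pos (by linarith)
    have a2 : |1 - 2 * ε| = 1 - 2 * ε := abs_of_pos (by linarith)
    have hne : (1 + ε) + (1 - 2 * ε) ≠ 0 := by linarith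
    have key : (1 + ε) - ((1 + ε) * (1 + ε) - (1 - 2 * ε) * (1 - 2 * ε)) /
        (2 * ((1 + ε) + (1 - 2 * ε))) = 1 - ε / 2 := by
      rw [sub_eq_iff_eq_add, ← sub_eq_iff_eq_add', eq_div_iff (mul_ne_zero two_ne_zero hne)]
      ring
    simp only [hcUpdate, f1, f2, e, a1, a2, key]
  have hB : ∀ ε : ℝ, 0 < ε → ε < 1 / 2 →
      hcUpdate (1 - ε, 1 - ε) = (1 + ε / 2, 1 + ε / 2) := by
    intro ε h0 h1
    have e : (3 : ℝ) - (1 - ε) - (1 - ε) = 1 + 2 * ε := by ring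
    have a1 : |1 - ε| = 1 - ε := abs_of_pos (by linarith)
    have a2 : |1 + 2 * ε| = 1 + 2 * ε := abs_of_pos (by linarith)
    have hne : (1 - ε) + (1 + 2 * ε) ≠ 0 := by linarith
    have key : (1 - ε) - ((1 - ε) * (1 - ε) - (1 + 2 * ε) * (1 + 2 * ε)) /
        (2 * ((1 - ε) + (1 + 2 * ε))) = 1 + ε / 2 := by
      rw [sub_eq_iff_eq_add, ← sub_eq_iff_eq_add', eq_div_iff (mul_ne_zero two_ne_zero hne)]
      ring
    simp only [hcUpdate, f1, f2, e, a1, a2, key]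
  have inj : ∀ a b : ℝ, a * |a| - b * |b| = 0 → a = b := by
    intro a b h
    rcases abs_cases a with ⟨ha, ha'⟩ | ⟨ha, ha'⟩ <;>
      rcases abs_cases b with ⟨hb, hb'⟩ | ⟨hb, hb'⟩ <;> rw [ha, hb] at h <;> nlinarith
  refine ⟨?_, ?_⟩
  · rintro ⟨x, y⟩
    constructor
    · rintro ⟨h1, h2⟩
      have e1 := inj _ _ h1
      have e2 := inj _ _ h2
      simp only at e1 e2
      ext <;> simp only <;> linarith
    · intro h
      rw [h]
      norm_num [f1, f2]
  · intro ε h0 h1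
    refine ⟨hA ε h0 h1, hB ε h0 h1, ?_, ?_⟩
    · rw [hA ε h0 h1]
      have e1 : (1 : ℝ) - ε / 2 - 1 = -(ε / 2) := by ring
      have e2 : (1 : ℝ) + ε - 1 = ε := by ring
      simp only [Prod.mk_sub_mk, Prod.norm_mk, max_self, e1, e2, Real.norm_eq_abs, abs_neg]
      rw [abs_of_pos h0, abs_of_pos (half_pos h0)]
      ring
    · rw [hB ε h0 h1]
      have e1 : (1 : ℝ) + ε / 2 - 1 = ε / 2 := by ring
      have e2 : (1 : ℝ) - ε - 1 = -ε := by ring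
      simp only [Prod.mk_sub_mk, Prod.norm_mk, max_self, e1, e2, Real.norm_eq_abs, abs_neg]
      rw [abs_of_pos h0, abs_of_pos (half_pos h0)]
      ring
end
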